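/- arXiv:0712.3649 — 2 statements merged into one kernel-verified Lean document; each statement's English description precedes it below -/
import Mathlib

section
/- The number of rooted planar maps with n edges equals 2 * 3^n * (2n)! / ((n+2)! * n!). -/
/-- A rooted combinatorial map on the dart set `Fin D`: a vertex-rotation
permutation `σ`, an edge involution `α` without fixed points pairing the two
darts of each edge, a root dart, and connectivity of the underlying graph
(the group generated by `σ` and `α` acts transitively on darts).  Faces are
the cycles of `σ * α`. -/
structure RootedMap (D : ℕ) where
  σ : Equiv.Perm (Fin D)
  α : Equiv.Perm (Fin D)
  root : Fin D
  α_invol : ∀ d, α (α d) = d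
  α_fpf : ∀ d, α d ≠ d
  connected : ∀ d e : Fin D,
    ∃ g ∈ Subgroup.closure ({σ, α} : Set (Equiv.Perm (Fin D))), g d = e

/-- Isomorphism of rooted maps: a relabelling of darts commuting with the two
permutations and preserving the root. -/
def MapIso {D : ℕ} (M M' : RootedMap D) : Prop :=
  ∃ e : Equiv.Perm (Fin D), (∀ d, e (M.σ d) = M'.σ (e d)) ∧
    (∀ d, e (M.α d) = M'.α (e d)) ∧ e M.root = M'.root

/-- The number of orbits (cycles, including fixed points) of a permutation:
the number of vertices when applied to `σ`, of faces when applied to `σ * α`. -/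
noncomputable def orbitCount {m : ℕ} (π : Equiv.Perm (Fin m)) : ℕ :=
  Nat.card (MulAction.orbitRel.Quotient (Subgroup.zpowers π) (Fin m))

/-- The number of orbits of size `i` of a permutation: the number of vertices of
degree `i` when `π` is the vertex rotation of a combinatorial map. -/
noncomputable def orbitCountOfSize {m : ℕ} (π : Equiv.Perm (Fin m)) (i : ℕ) : ℕ :=
  Nat.card {o : MulAction.orbitRel.Quotient (Subgroup.zpowers π) (Fin m) //
    Nat.card o.orbit = i}

/-- A rooted planar map with `n` edges: a rooted map on `2n` darts whose Euler
characteristic is `2`, i.e. `v + f = n + 2`. -/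
def IsPlanarMap {n : ℕ} (M : RootedMap (2 * n)) : Prop :=
  orbitCount M.σ + orbitCount (M.σ * M.α) = n + 2

namespace MapCount

open Equiv Equiv.Perm

/-! ### Counting classes of setoids and cycles of permutations -/

section Cycles

variable {X Y : Type*}

/-- The number of classes of a setoid. -/
noncomputable def classCount (r : Setoid X) : ℕ := Nat.card (Quotient r)

/-- The partition of `X` into cycles of `π`. -/
abbrev cyc (π : Perm X) : Setoid X := SameCycle.setoid π

/-- The number of cycles of `π`, fixed points included. -/
noncomputable def cycleCount (π : Perm X) : ℕ := classCount (cyc π)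

/-- The partition of `X` into orbits of the group generated by `σ` and `α`. -/
def orb (σ α : Perm X) : Setoid X := cyc σ ⊔ cyc α

theorem cyc_apply {π : Perm X} {x y : X} : cyc π x y ↔ SameCycle π x y := Iff.rfl

theorem cyc_le_iff {π : Perm X} {s : Setoid X} : cyc π ≤ s ↔ ∀ x, s x (π x) := by
  constructor
  · intro h x
    exact h (sameCycle_apply_right.2 (SameCycle.refl π x))
  · rintro h x y ⟨i, rfl⟩
    induction i with
    | zero => exact s.refl x
    | succ n ih =>
      rw [add_comm, zpow_add, zpow_one]
      exact s.trans ih (h _)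
    | pred n ih =>
      have := h ((π ^ (-(n : ℤ) - 1)) x)
      rw [← Perm.mul_apply, ← zpow_one_add, add_sub_cancel] at this
      exact s.trans ih (s.symm this)

theorem cyc_self_apply (π : Perm X) (x : X) : cyc π x (π x) := cyc_le_iff.1 le_rfl x

theorem cyc_one : cyc (1 : Perm X) = ⊥ :=
  le_bot_iff.1 (cyc_le_iff.2 fun _ => rfl)

theorem cyc_mul_le (π τ : Perm X) : cyc (π * τ) ≤ cyc π ⊔ cyc τ := by
  refine cyc_le_iff.2 fun x => ?_
  refine (cyc π ⊔ cyc τ).trans (le_sup_right (a := cyc π) (cyc_self_apply τ x)) ?_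
  exact le_sup_left (b := cyc τ) (cyc_self_apply π (τ x))

theorem cyc_mul_le_orb (σ α : Perm X) : cyc (σ * α) ≤ orb σ α := cyc_mul_le σ α

theorem orb_rel_left (σ α : Perm X) (x : X) : orb σ α x (σ x) :=
  le_sup_left (a := cyc σ) (b := cyc α) (cyc_self_apply σ x)

theorem orb_rel_right (σ α : Perm X) (x : X) : orb σ α x (α x) :=
  le_sup_right (a := cyc σ) (b := cyc α) (cyc_self_apply α x)

theorem orb_le_iff {σ α : Perm X} {s : Setoid X} :
    orb σ α ≤ s ↔ (∀ x, s x (σ x)) ∧ ∀ x, s x (α x) := by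
  rw [orb, sup_le_iff, cyc_le_iff, cyc_le_iff]

section Swap

variable [DecidableEq X]

theorem cyc_swap_le_iff {a b : X} {s : Setoid X} : cyc (swap a b) ≤ s ↔ s a b := by
  rw [cyc_le_iff]
  refine ⟨fun h => by simpa using h a, fun h x => ?_⟩
  rcases eq_or_ne x a with rfl | hxa
  · simpa using h
  rcases eq_or_ne x b with rfl | hxb
  · simpa using s.symm h
  · rw [swap_apply_of_ne_of_ne hxa hxb]

theorem cyc_swap_apply (a b : X) : cyc (swap a b) a b := cyc_swap_le_iff.1 le_rfl

theorem sup_cyc_swap_of_rel {r : Setoid X} {a b : X} (h : r a b) : r ⊔ cyc (swap a b) = r :=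
  sup_eq_left.2 (cyc_swap_le_iff.2 h)

theorem classCount_sup_cyc_swap [Finite X] {r : Setoid X} {a b : X} (h : ¬ r a b) :
    classCount (r ⊔ cyc (swap a b)) + 1 = classCount r := by
  classical
  let f : X → Quotient r := fun x => if r b x then ⟦a⟧ else ⟦x⟧
  have hf : r ⊔ cyc (swap a b) = Setoid.ker f := by
    apply le_antisymm
    · refine sup_le (fun x y hxy => ?_) (cyc_swap_le_iff.2 ?_)
      · have : r b x ↔ r b y := ⟨fun h => r.trans h hxy, fun h => r.trans h (r.symm hxy)⟩
        simp only [Setoid.ker_def, f, this]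
        split_ifs
        · rfl
        · exact Quotient.sound hxy
      · have : ¬ r b a := fun h' => h (r.symm h')
        simp [Setoid.ker_def, f]
    · have key : ∀ x, ∃ z, f x = ⟦z⟧ ∧ (r ⊔ cyc (swap a b)) x z := by
        intro x
        by_cases hx : r b x
        · refine ⟨a, by simp [f, hx], ?_⟩
          refine Setoid.trans' _ (le_sup_left (a := r) (r.symm hx)) ?_
          exact Setoid.symm' _ (le_sup_right (a := r) (cyc_swap_apply a b))
        · exact ⟨x, by simp [f, hx], Setoid.refl' _ x⟩
      intro x y hxy
      obtain ⟨z, hz, hxz⟩ := key x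
      obtain ⟨w, hw, hyw⟩ := key y
      have hzw : r z w := by
        rw [Setoid.ker_def, hz, hw] at hxy
        exact Quotient.exact hxy
      exact Setoid.trans' _ hxz (Setoid.trans' _ (le_sup_left (a := r) hzw) (Setoid.symm' _ hyw))
  have hrange : Set.range f = {(⟦b⟧ : Quotient r)}ᶜ := by
    ext q
    constructor
    · rintro ⟨x, rfl⟩
      by_cases hx : r b x
      · simp only [f, hx, if_true, Set.mem_compl_iff, Set.mem_singleton_iff]
        exact fun h' => h (Quotient.exact h')
      · simp only [f, hx, if_false, Set.mem_compl_iff, Set.mem_singleton_iff]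
        exact fun h' => hx (r.symm (Quotient.exact h'))
    · intro hq
      induction q using Quotient.inductionOn with | _ x => ?_
      have hx : ¬ r b x := fun h' => hq (Quotient.sound (r.symm h'))
      exact ⟨x, by simp [f, hx]⟩
  rw [classCount, hf, Nat.card_congr (Setoid.quotientKerEquivRange f), hrange, Nat.card_coe_set_eq,
    Set.ncard_compl, Set.ncard_singleton, classCount]
  have : Nonempty (Quotient r) := ⟨⟦a⟧⟩
  have := Nat.card_pos (α := Quotient r)
  omega

theorem cyc_mul_swap_sup (π : Perm X) (a b : X) :
    cyc (π * swap a b) ⊔ cyc (swap a b) = cyc π ⊔ cyc (swap a b) := by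
  apply le_antisymm
  · exact sup_le (cyc_mul_le _ _) le_sup_right
  · refine sup_le ?_ le_sup_right
    have := cyc_mul_le (π * swap a b) (swap a b)
    rwa [mul_assoc, swap_mul_self, mul_one] at this

theorem sameCycle_mul_swap [Finite X] {π : Perm X} {a b : X} (h : ¬ SameCycle π a b) :
    SameCycle (π * swap a b) a b := by
  set ρ := π * swap a b with hρ
  have hb : ρ b = π a := by simp [hρ]
  by_contra hab
  have key : ∀ k : ℕ, SameCycle ρ b ((π ^ (k + 1)) a) := by
    intro k
    induction k with
    | zero => simpa [← hb] using SameCycle.refl ρ b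
    | succ k ih =>
      have h1 : (π ^ (k + 1)) a ≠ a := fun h' => hab (by rw [h'] at ih; exact ih.symm)
      have h2 : (π ^ (k + 1)) a ≠ b := fun h' => h ⟨(k + 1 : ℕ), by rw [zpow_natCast, h']⟩
      rw [pow_succ', Perm.mul_apply]
      have : ρ ((π ^ (k + 1)) a) = π ((π ^ (k + 1)) a) := by
        rw [hρ, Perm.mul_apply, swap_apply_of_ne_of_ne h1 h2]
      rw [← this]
      exact sameCycle_apply_right.2 ih
  have := key (orderOf π - 1)
  rw [Nat.sub_add_cancel (orderOf_pos π), pow_orderOf_eq_one] at this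
  exact hab this.symm

theorem not_sameCycle_mul_swap [Finite X] {π : Perm X} {a b : X} (hab : a ≠ b)
    (h : SameCycle π a b) : ¬ SameCycle (π * swap a b) a b := by
  classical
  set ρ := π * swap a b with hρ
  have hex : ∃ m, 0 < m ∧ (π ^ m) b = a := by
    obtain ⟨m, hm, -, h'⟩ := h.symm.exists_pow_eq''
    exact ⟨m, hm, h'⟩
  obtain ⟨hm, hma⟩ := Nat.find_spec hex
  set m := Nat.find hex
  have hmin : ∀ i, 0 < i → i < m → (π ^ i) b ≠ a := fun i hi him h' =>
    Nat.find_min hex him ⟨hi, h'⟩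
  have hminb : ∀ i, 0 < i → i < m → (π ^ i) b ≠ b := by
    intro i hi him h'
    apply hmin (m - i) (by omega) (by omega)
    rw [← hma]
    conv_rhs => rw [← Nat.sub_add_cancel him.le, pow_add, Perm.mul_apply, h']
  have key : ∀ n : ℕ, ∃ i, 0 < i ∧ i ≤ m ∧ (ρ ^ n) a = (π ^ i) b := by
    intro n
    induction n with
    | zero => exact ⟨m, hm, le_rfl, by simp [hma]⟩
    | succ n ih =>
      obtain ⟨i, hi, him, h'⟩ := ih
      rw [pow_succ', Perm.mul_apply, h']
      rcases him.eq_or_lt with rfl | him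
      · exact ⟨1, one_pos, hm, by simp [hρ, hma]⟩
      · refine ⟨i + 1, by omega, him, ?_⟩
        rw [hρ, Perm.mul_apply, swap_apply_of_ne_of_ne (hmin i hi him) (hminb i hi him), pow_succ',
          Perm.mul_apply]
  intro hρab
  obtain ⟨n, -, hn⟩ := hρab.exists_pow_eq'
  obtain ⟨i, hi, him, h'⟩ := key n
  rw [hn] at h'
  rcases him.eq_or_lt with rfl | him
  · exact hab (by rw [← hma, ← h'])
  · exact hminb i hi him h'.symm

theorem cyc_mul_swap [Finite X] {π : Perm X} {a b : X} (h : ¬ SameCycle π a b) :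
    cyc (π * swap a b) = cyc π ⊔ cyc (swap a b) := by
  rw [← cyc_mul_swap_sup, sup_cyc_swap_of_rel (sameCycle_mul_swap h)]

theorem cycleCount_mul_swap_of_not [Finite X] {π : Perm X} {a b : X} (h : ¬ SameCycle π a b) :
    cycleCount (π * swap a b) + 1 = cycleCount π := by
  rw [cycleCount, cyc_mul_swap h, classCount_sup_cyc_swap h, cycleCount]

theorem cycleCount_mul_swap_of_sameCycle [Finite X] {π : Perm X} {a b : X} (hab : a ≠ b)
    (h : SameCycle π a b) : cycleCount (π * swap a b) = cycleCount π + 1 := by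
  rw [← cycleCount_mul_swap_of_not (not_sameCycle_mul_swap hab h), mul_assoc, swap_mul_self,
    mul_one]

theorem orb_mul_swap_sup (σ α : Perm X) (a b : X) :
    orb σ (α * swap a b) ⊔ cyc (swap a b) = orb σ α ⊔ cyc (swap a b) := by
  rw [orb, orb, sup_assoc, cyc_mul_swap_sup, sup_assoc]

end Swap

theorem cycleCount_le_card [Finite X] (π : Perm X) : cycleCount π ≤ Nat.card X :=
  Nat.card_le_card_of_surjective _ Quotient.mk_surjective

theorem cycleCount_one : cycleCount (1 : Perm X) = Nat.card X := by
  rw [cycleCount, classCount, cyc_one]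
  exact Nat.card_congr Setoid.quotientBotEquiv

/-- The genus of a combinatorial map is nonnegative. -/
theorem cycleCount_add_le [Finite X] (σ α : Perm X) :
    cycleCount σ + cycleCount α + cycleCount (σ * α) ≤ Nat.card X + 2 * classCount (orb σ α) := by
  classical
  induction hk : Nat.card X - cycleCount α using Nat.strong_induction_on generalizing α with
  | _ k ih => ?_
  by_cases hα : α = 1
  · subst hα
    have : orb σ 1 = cyc σ := by rw [orb, cyc_one, sup_bot_eq]
    rw [mul_one, this, cycleCount_one, ← cycleCount]
    omega
  obtain ⟨a, ha⟩ : ∃ a, α a ≠ a := by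
    by_contra! h
    exact hα (Equiv.ext h)
  set b := α a
  set α' := α * swap a b with hα'
  have hαα' : α = α' * swap a b := by rw [hα', mul_assoc, swap_mul_self, mul_one]
  have h1 : cycleCount α' = cycleCount α + 1 :=
    cycleCount_mul_swap_of_sameCycle ha.symm (cyc_self_apply α a)
  have h2 := cycleCount_le_card α'
  have h3 := ih _ (by omega) α' rfl
  have h4 : σ * α = σ * α' * swap a b := by rw [mul_assoc, ← hαα']
  have h5 := orb_mul_swap_sup σ α a b
  rw [← hα', sup_cyc_swap_of_rel (orb_rel_right σ α a)] at h5
  by_cases hr : orb σ α' a b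
  · rw [sup_cyc_swap_of_rel hr] at h5
    have h6 : cycleCount (σ * α) ≤ cycleCount (σ * α') + 1 := by
      rw [h4]
      by_cases hs : SameCycle (σ * α') a b
      · rw [cycleCount_mul_swap_of_sameCycle ha.symm hs]
      · have := cycleCount_mul_swap_of_not hs
        omega
    rw [← h5]
    omega
  · have hs : ¬ SameCycle (σ * α') a b := fun h => hr (cyc_mul_le_orb σ α' h)
    have h6 := cycleCount_mul_swap_of_not hs
    have h7 := classCount_sup_cyc_swap hr
    rw [h5] at h7
    rw [h4]
    omega

end Cycles

section Transport

variable {X Y : Type*}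

/-! ### Transport along an equivalence -/

theorem cyc_permCongr (e : X ≃ Y) (π : Perm X) :
    cyc (e.permCongr π) = (cyc π).comap e.symm := by
  apply le_antisymm
  · refine cyc_le_iff.2 fun y => ?_
    rw [Setoid.comap_rel]
    simpa [Equiv.permCongr_apply] using cyc_self_apply π (e.symm y)
  · have : cyc π ≤ (cyc (e.permCongr π)).comap e := by
      refine cyc_le_iff.2 fun x => ?_
      rw [Setoid.comap_rel]
      simpa [Equiv.permCongr_apply] using cyc_self_apply (e.permCongr π) (e x)
    intro x y hxy
    simpa [Setoid.comap_rel] using this hxy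

theorem comap_symm_sup (e : X ≃ Y) (r s : Setoid X) :
    (r ⊔ s).comap e.symm = r.comap e.symm ⊔ s.comap e.symm := by
  apply le_antisymm
  · have : r ⊔ s ≤ (r.comap e.symm ⊔ s.comap e.symm).comap e := by
      refine sup_le (fun x y h => ?_) (fun x y h => ?_)
      · exact le_sup_left (a := r.comap e.symm) (by simpa [Setoid.comap_rel] using h)
      · exact le_sup_right (a := r.comap e.symm) (by simpa [Setoid.comap_rel] using h)
    intro x y hxy
    simpa [Setoid.comap_rel] using this hxy
  · exact sup_le (fun x y h => le_sup_left (a := r) (b := s) h)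
      (fun x y h => le_sup_right (a := r) (b := s) h)

theorem classCount_comap_symm (e : X ≃ Y) (r : Setoid X) :
    classCount (r.comap e.symm) = classCount r := by
  refine (Nat.card_congr (Quotient.congr e fun x y => ?_)).symm
  change r x y ↔ r (e.symm (e x)) (e.symm (e y))
  simp

theorem cycleCount_permCongr (e : X ≃ Y) (π : Perm X) :
    cycleCount (e.permCongr π) = cycleCount π := by
  rw [cycleCount, cyc_permCongr, classCount_comap_symm, cycleCount]

theorem orb_permCongr (e : X ≃ Y) (σ α : Perm X) :
    orb (e.permCongr σ) (e.permCongr α) = (orb σ α).comap e.symm := by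
  rw [orb, cyc_permCongr, cyc_permCongr, ← comap_symm_sup, orb]

theorem permCongr_mul' (e : X ≃ Y) (σ α : Perm X) :
    e.permCongr σ * e.permCongr α = e.permCongr (σ * α) := by
  ext y; simp [Equiv.permCongr_apply]

/-- A period is preserved by an injective semiconjugacy. -/
theorem minimalPeriod_semiconj {f : X → X} {g : Y → Y} {i : X → Y} (hi : Function.Injective i)
    (h : ∀ x, i (f x) = g (i x)) (x : X) :
    Function.minimalPeriod g (i x) = Function.minimalPeriod f x := by
  rw [Function.minimalPeriod_eq_minimalPeriod_iff]
  intro n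
  have : Function.Semiconj i f g := h
  rw [Function.IsPeriodicPt, Function.IsPeriodicPt, Function.IsFixedPt, Function.IsFixedPt,
    ← (this.iterate_right n) x, hi.eq_iff]

theorem minimalPeriod_permCongr (e : X ≃ Y) (π : Perm X) (x : X) :
    Function.minimalPeriod (e.permCongr π) (e x) = Function.minimalPeriod π x :=
  minimalPeriod_semiconj e.injective (fun x => by simp [Equiv.permCongr_apply]) x

end Transport

section Sum

variable {X Y : Type*}

/-! ### Disjoint unions -/

/-- The disjoint union of two setoids. -/
def sumSetoid (r : Setoid X) (s : Setoid Y) : Setoid (X ⊕ Y) :=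
  Setoid.ker (Sum.map (Quotient.mk r) (Quotient.mk s))

theorem sumSetoid_inl {r : Setoid X} {s : Setoid Y} {x y : X} :
    sumSetoid r s (.inl x) (.inl y) ↔ r x y := by
  rw [sumSetoid, Setoid.ker_def, Sum.map_inl, Sum.map_inl, Sum.inl.injEq]
  exact Quotient.eq

theorem sumSetoid_inr {r : Setoid X} {s : Setoid Y} {x y : Y} :
    sumSetoid r s (.inr x) (.inr y) ↔ s x y := by
  rw [sumSetoid, Setoid.ker_def, Sum.map_inr, Sum.map_inr, Sum.inr.injEq]
  exact Quotient.eq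

theorem not_sumSetoid_inl_inr {r : Setoid X} {s : Setoid Y} {x : X} {y : Y} :
    ¬ sumSetoid r s (.inl x) (.inr y) := by
  rw [sumSetoid, Setoid.ker_def]
  simp

theorem sumSetoid_le_iff {r : Setoid X} {s : Setoid Y} {t : Setoid (X ⊕ Y)} :
    sumSetoid r s ≤ t ↔ r ≤ t.comap Sum.inl ∧ s ≤ t.comap Sum.inr := by
  constructor
  · intro h
    exact ⟨fun x y hxy => h (sumSetoid_inl.2 hxy), fun x y hxy => h (sumSetoid_inr.2 hxy)⟩
  · rintro ⟨h1, h2⟩ (x | x) (y | y) hxy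
    · exact h1 (sumSetoid_inl.1 hxy)
    · exact absurd hxy not_sumSetoid_inl_inr
    · exact absurd (Setoid.symm' _ hxy) not_sumSetoid_inl_inr
    · exact h2 (sumSetoid_inr.1 hxy)

theorem sumSetoid_sup (r r' : Setoid X) (s s' : Setoid Y) :
    sumSetoid r s ⊔ sumSetoid r' s' = sumSetoid (r ⊔ r') (s ⊔ s') := by
  apply le_antisymm
  · refine sup_le (sumSetoid_le_iff.2 ⟨?_, ?_⟩) (sumSetoid_le_iff.2 ⟨?_, ?_⟩) <;> intro x y h
    · exact sumSetoid_inl.2 (le_sup_left (a := r) h)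
    · exact sumSetoid_inr.2 (le_sup_left (a := s) h)
    · exact sumSetoid_inl.2 (le_sup_right (a := r) h)
    · exact sumSetoid_inr.2 (le_sup_right (a := s) h)
  · obtain ⟨h1, h2⟩ := sumSetoid_le_iff.1 (le_sup_left : sumSetoid r s ≤ _ ⊔ sumSetoid r' s')
    obtain ⟨h3, h4⟩ := sumSetoid_le_iff.1 (le_sup_right : sumSetoid r' s' ≤ sumSetoid r s ⊔ _)
    exact sumSetoid_le_iff.2 ⟨sup_le h1 h3, sup_le h2 h4⟩

theorem classCount_sumSetoid [Finite X] [Finite Y] (r : Setoid X) (s : Setoid Y) :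
    classCount (sumSetoid r s) = classCount r + classCount s := by
  rw [classCount, sumSetoid, Nat.card_congr (Setoid.quotientKerEquivOfSurjective _
    (Sum.map_surjective.2 ⟨Quotient.mk_surjective, Quotient.mk_surjective⟩)), Nat.card_sum]
  rfl

theorem cyc_sumCongr (π : Perm X) (τ : Perm Y) :
    cyc (Perm.sumCongr π τ) = sumSetoid (cyc π) (cyc τ) := by
  apply le_antisymm
  · refine cyc_le_iff.2 ?_
    rintro (x | x)
    · exact sumSetoid_inl.2 (cyc_self_apply π x)
    · exact sumSetoid_inr.2 (cyc_self_apply τ x)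
  · refine sumSetoid_le_iff.2 ⟨cyc_le_iff.2 fun x => ?_, cyc_le_iff.2 fun x => ?_⟩
    · exact cyc_self_apply (Perm.sumCongr π τ) (.inl x)
    · exact cyc_self_apply (Perm.sumCongr π τ) (.inr x)

theorem cycleCount_sumCongr [Finite X] [Finite Y] (π : Perm X) (τ : Perm Y) :
    cycleCount (Perm.sumCongr π τ) = cycleCount π + cycleCount τ := by
  rw [cycleCount, cyc_sumCongr, classCount_sumSetoid, cycleCount, cycleCount]

theorem orb_sumCongr (σ α : Perm X) (σ' α' : Perm Y) :
    orb (Perm.sumCongr σ σ') (Perm.sumCongr α α') = sumSetoid (orb σ α) (orb σ' α') := by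
  rw [orb, cyc_sumCongr, cyc_sumCongr, sumSetoid_sup, orb, orb]

end Sum

section Option

variable {X : Type*}

/-! ### Adding an isolated point -/

/-- The setoid on `Option X` in which `none` is alone in its class. -/
def optSetoid (r : Setoid X) : Setoid (Option X) := Setoid.ker (Option.map (Quotient.mk r))

theorem optSetoid_some {r : Setoid X} {x y : X} :
    optSetoid r (some x) (some y) ↔ r x y := by
  rw [optSetoid, Setoid.ker_def, Option.map_some, Option.map_some, Option.some.injEq]
  exact Quotient.eq

theorem not_optSetoid_none {r : Setoid X} {x : X} : ¬ optSetoid r none (some x) := by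
  rw [optSetoid, Setoid.ker_def]
  simp

theorem optSetoid_le_iff {r : Setoid X} {t : Setoid (Option X)} :
    optSetoid r ≤ t ↔ r ≤ t.comap some := by
  constructor
  · intro h x y hxy
    exact h (optSetoid_some.2 hxy)
  · rintro h (_ | x) (_ | y) hxy
    · exact Setoid.refl' _ _
    · exact absurd hxy not_optSetoid_none
    · exact absurd (Setoid.symm' _ hxy) not_optSetoid_none
    · exact h (optSetoid_some.1 hxy)

theorem optSetoid_sup (r s : Setoid X) : optSetoid r ⊔ optSetoid s = optSetoid (r ⊔ s) := by
  apply le_antisymm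
  · refine sup_le (optSetoid_le_iff.2 ?_) (optSetoid_le_iff.2 ?_) <;> intro x y h
    · exact optSetoid_some.2 (le_sup_left (a := r) h)
    · exact optSetoid_some.2 (le_sup_right (a := r) h)
  · exact optSetoid_le_iff.2 (sup_le (optSetoid_le_iff.1 le_sup_left)
      (optSetoid_le_iff.1 le_sup_right))

theorem classCount_optSetoid [Finite X] (r : Setoid X) :
    classCount (optSetoid r) = classCount r + 1 := by
  rw [classCount, optSetoid, Nat.card_congr (Setoid.quotientKerEquivOfSurjective _
    (by rintro (_ | q); exacts [⟨none, rfl⟩, (Quotient.mk_surjective q).imp' some (by simp)])),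
    Finite.card_option]
  rfl

theorem cyc_optionCongr (π : Perm X) : cyc (optionCongr π) = optSetoid (cyc π) := by
  apply le_antisymm
  · refine cyc_le_iff.2 ?_
    rintro (_ | x)
    · exact Setoid.refl' _ _
    · exact optSetoid_some.2 (cyc_self_apply π x)
  · exact optSetoid_le_iff.2 (cyc_le_iff.2 fun x => cyc_self_apply (optionCongr π) (some x))

theorem cycleCount_optionCongr [Finite X] (π : Perm X) :
    cycleCount (optionCongr π) = cycleCount π + 1 := by
  rw [cycleCount, cyc_optionCongr, classCount_optSetoid, cycleCount]

theorem optionCongr_mul (σ α : Perm X) :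
    optionCongr σ * optionCongr α = optionCongr (σ * α) := by
  ext x : 1; cases x <;> rfl

/-! ### Inserting a point into a cycle -/

/-- The setoid on `Option X` in which `none` joins the class of `a`. -/
def insSetoid (r : Setoid X) (a : X) : Setoid (Option X) :=
  Setoid.ker fun o => o.elim (Quotient.mk r a) (Quotient.mk r)

theorem insSetoid_some {r : Setoid X} {a x y : X} :
    insSetoid r a (some x) (some y) ↔ r x y := by
  rw [insSetoid, Setoid.ker_def]
  exact Quotient.eq

theorem insSetoid_none {r : Setoid X} {a x : X} : insSetoid r a none (some x) ↔ r a x := by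
  rw [insSetoid, Setoid.ker_def]
  exact Quotient.eq

theorem classCount_insSetoid (r : Setoid X) (a : X) :
    classCount (insSetoid r a) = classCount r := by
  rw [classCount, insSetoid, Nat.card_congr (Setoid.quotientKerEquivOfSurjective _ ?_), classCount]
  intro q
  obtain ⟨x, rfl⟩ := Quotient.mk_surjective q
  exact ⟨some x, rfl⟩

variable [DecidableEq X]

theorem optSetoid_sup_swap (r : Setoid X) (a : X) :
    optSetoid r ⊔ cyc (swap none (some a)) = insSetoid r a := by
  apply le_antisymm
  · refine sup_le (optSetoid_le_iff.2 fun x y h => insSetoid_some.2 h) (cyc_swap_le_iff.2 ?_)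
    exact insSetoid_none.2 (r.refl a)
  · have h : ∀ x y, r x y → (optSetoid r ⊔ cyc (swap none (some a))) (some x) (some y) :=
      fun x y hxy => le_sup_left (a := optSetoid r) (optSetoid_some.2 hxy)
    have h' : ∀ y, r a y → (optSetoid r ⊔ cyc (swap none (some a))) none (some y) := fun y hy =>
      Setoid.trans' _ (le_sup_right (a := optSetoid r) (cyc_swap_apply _ _)) (h a y hy)
    rintro (_ | x) (_ | y) hxy
    · exact Setoid.refl' _ _
    · exact h' y (insSetoid_none.1 hxy)
    · exact Setoid.symm' _ (h' x (insSetoid_none.1 (Setoid.symm' _ hxy)))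
    · exact h x y (insSetoid_some.1 hxy)

/-- Insert `none` right after `a` in its cycle. -/
def ins (π : Perm X) (a : X) : Perm (Option X) := optionCongr π * swap none (some a)

@[simp] theorem ins_none (π : Perm X) (a : X) : ins π a none = some (π a) := by simp [ins]

@[simp] theorem ins_some_self (π : Perm X) (a : X) : ins π a (some a) = none := by simp [ins]

theorem ins_some_of_ne (π : Perm X) {a x : X} (h : x ≠ a) : ins π a (some x) = some (π x) := by
  rw [ins, Perm.mul_apply, swap_apply_of_ne_of_ne (by simp) (by simpa using h)]
  rfl

theorem ins_some (π : Perm X) (a x : X) :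
    ins π a (some x) = if x = a then none else some (π x) := by
  split_ifs with h
  · rw [h, ins_some_self]
  · exact ins_some_of_ne π h

theorem ins_injective (a : X) : Function.Injective fun π : Perm X => ins π a := fun _ _ h =>
  optionCongr_injective (mul_right_cancel h)

theorem optionCongr_removeNone_of_none {π : Perm (Option X)} (h : π none = none) :
    optionCongr (removeNone π) = π := by
  rw [map_equiv_removeNone, h, swap_self]; rfl

theorem exists_eq_ins {π : Perm (Option X)} {a : X} (h : π (some a) = none) :
    ∃ τ : Perm X, π = ins τ a := by
  refine ⟨removeNone (π * swap none (some a)), ?_⟩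
  rw [ins, optionCongr_removeNone_of_none (by simpa using h), mul_assoc, swap_mul_self, mul_one]

theorem ins_mul_optionCongr (σ α : Perm X) {a : X} :
    ins σ (α a) * optionCongr α = ins (σ * α) a := by
  ext x : 1
  rcases x with _ | x
  · simp
  · simp [ins_some]

theorem ins_mul_ins (σ α : Perm X) {a b : X} (ha : α a = a) :
    ins σ a * ins α b = ins (σ * α) a * swap none (some b) := by
  rw [ins, ins, ins, ← mul_assoc, mul_assoc (optionCongr σ), ← optionCongr_mul]
  have : swap none (some a) * optionCongr α = optionCongr α * swap none (some a) := by
    rw [mul_swap_eq_swap_mul]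
    simp [ha]
  rw [this]; simp only [mul_assoc]

variable [Finite X]

theorem cyc_ins (π : Perm X) (a : X) : cyc (ins π a) = insSetoid (cyc π) a := by
  rw [ins, cyc_mul_swap, cyc_optionCongr, optSetoid_sup_swap]
  rw [← cyc_apply, cyc_optionCongr]
  exact not_optSetoid_none

theorem cycleCount_ins (π : Perm X) (a : X) : cycleCount (ins π a) = cycleCount π := by
  rw [cycleCount, cyc_ins, classCount_insSetoid, cycleCount]

theorem orb_ins_optionCongr (σ α : Perm X) (a : X) :
    orb (ins σ a) (optionCongr α) = insSetoid (orb σ α) a := by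
  rw [orb, cyc_ins, cyc_optionCongr, ← optSetoid_sup_swap, sup_right_comm, optSetoid_sup,
    optSetoid_sup_swap, orb]

theorem orb_ins_ins (σ α : Perm X) (a b : X) :
    orb (ins σ a) (ins α b) = insSetoid (orb σ α) a ⊔ cyc (swap none (some b)) := by
  rw [orb, cyc_ins, cyc_ins, ← optSetoid_sup_swap, ← optSetoid_sup_swap,
    sup_sup_sup_comm, optSetoid_sup, ← sup_assoc, optSetoid_sup_swap, orb]

theorem classCount_orb_ins_ins_of_rel {σ α : Perm X} {a b : X} (h : orb σ α a b) :
    classCount (orb (ins σ a) (ins α b)) = classCount (orb σ α) := by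
  rw [orb_ins_ins, sup_cyc_swap_of_rel (insSetoid_none.2 h), classCount_insSetoid]

theorem classCount_orb_ins_ins_of_not_rel {σ α : Perm X} {a b : X} (h : ¬ orb σ α a b) :
    classCount (orb (ins σ a) (ins α b)) + 1 = classCount (orb σ α) := by
  rw [orb_ins_ins, classCount_sup_cyc_swap fun h' => h (insSetoid_none.1 h'),
    classCount_insSetoid]

theorem cycleCount_ins_mul_ins_of_sameCycle {σ α : Perm X} {a b : X} (ha : α a = a)
    (h : SameCycle (σ * α) a b) : cycleCount (ins σ a * ins α b) = cycleCount (σ * α) + 1 := by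
  rw [ins_mul_ins σ α ha, cycleCount_mul_swap_of_sameCycle (by simp), cycleCount_ins]
  rw [← cyc_apply, cyc_ins]
  exact insSetoid_none.2 h

theorem cycleCount_ins_mul_ins_of_not_sameCycle {σ α : Perm X} {a b : X} (ha : α a = a)
    (h : ¬ SameCycle (σ * α) a b) : cycleCount (ins σ a * ins α b) + 1 = cycleCount (σ * α) := by
  rw [ins_mul_ins σ α ha, cycleCount_mul_swap_of_not, cycleCount_ins]
  rw [← cyc_apply, cyc_ins]
  exact fun h' => h (insSetoid_none.1 h')

end Option

section Periods

variable {X : Type*}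

/-! ### Periods -/

theorem minimalPeriod_eq_of_forall {f : X → X} {x : X} {p : ℕ} (hp : 0 < p) (h : f^[p] x = x)
    (hne : ∀ k, 0 < k → k < p → f^[k] x ≠ x) : Function.minimalPeriod f x = p := by
  refine (Function.IsPeriodicPt.minimalPeriod_le hp h).antisymm (not_lt.1 fun hlt => ?_)
  exact hne _ (Function.IsPeriodicPt.minimalPeriod_pos hp h) hlt Function.iterate_minimalPeriod

theorem iterate_ne_of_lt_minimalPeriod {f : X → X} {x : X} {i k : ℕ} (hik : i < k)
    (hk : k < Function.minimalPeriod f x) : f^[k] x ≠ f^[i] x := fun h => by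
  have := (Function.iterate_eq_iterate_iff_of_lt_minimalPeriod hk (hik.trans hk)).1 h
  omega

theorem minimalPeriod_perm_pos [Finite X] (π : Perm X) (x : X) :
    0 < Function.minimalPeriod π x :=
  Function.minimalPeriod_pos_of_mem_periodicPts (π.injective.mem_periodicPts x)

theorem sameCycle_iterate (π : Perm X) (x : X) (k : ℕ) : SameCycle π x (π^[k] x) := by
  rw [← Perm.coe_pow]
  exact ⟨k, by rw [zpow_natCast]⟩

theorem SameCycle.exists_iterate_lt [Finite X] {π : Perm X} {x y : X} (h : SameCycle π x y) :
    ∃ i < Function.minimalPeriod π x, π^[i] x = y := by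
  obtain ⟨n, -, hn⟩ := h.exists_pow_eq'
  refine ⟨n % Function.minimalPeriod π x, Nat.mod_lt _ (minimalPeriod_perm_pos π x), ?_⟩
  rw [Function.iterate_mod_minimalPeriod_eq, ← Perm.coe_pow, hn]

variable [DecidableEq X]

/-- Adding an edge inside the root face splits it. -/
theorem minimalPeriod_ins_ins_mul_swap {π : Perm X} {u : X} {i : ℕ}
    (hi : i < Function.minimalPeriod π u) :
    Function.minimalPeriod
      (ins (ins π (π^[i] u)) (some u) * swap none (some none) : Perm (Option (Option X)))
      (some (some u)) + i = Function.minimalPeriod π u + 1 := by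
  set y := π^[i] u with hy
  set Φ : Perm (Option (Option X)) := ins (ins π y) (some u) * swap none (some none) with hΦ
  set p := Function.minimalPeriod π u
  have h1 : Φ (some (some u)) = none := by
    rw [hΦ, Perm.mul_apply, swap_apply_of_ne_of_ne (by simp) (by simp), ins_some_self]
  have h2 : Φ none = some (some (π y)) := by
    rw [hΦ, Perm.mul_apply, swap_apply_left, ins_some_of_ne _ (by simp), ins_none]
  have h3 : ∀ x, x ≠ u → x ≠ y → Φ (some (some x)) = some (some (π x)) := fun x hu hx => by
    rw [hΦ, Perm.mul_apply, swap_apply_of_ne_of_ne (by simp) (by simp),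
      ins_some_of_ne _ (by simpa using hu), ins_some_of_ne _ hx]
  have A : ∀ k, i + k < p → Φ^[k + 2] (some (some u)) = some (some (π^[i + k + 1] u)) := by
    intro k
    induction k with
    | zero => intro _; simp [h1, h2, hy, Function.iterate_succ_apply']
    | succ k ih =>
      intro hk
      rw [Function.iterate_succ_apply', ih (by omega), h3, ← Function.iterate_succ_apply' π]
      · rfl
      · exact iterate_ne_of_lt_minimalPeriod (i := 0) (by omega) hk
      · exact iterate_ne_of_lt_minimalPeriod (by omega) hk
  suffices h : Function.minimalPeriod Φ (some (some u)) = p - i + 1 by omega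
  apply minimalPeriod_eq_of_forall (by omega)
  · have := A (p - i - 1) (by omega)
    rw [show p - i - 1 + 2 = p - i + 1 by omega, show i + (p - i - 1) + 1 = p by omega] at this
    rw [this, Function.iterate_minimalPeriod]
  · intro k hk hkd
    rcases k with _ | _ | k
    · omega
    · simp [h1]
    · rw [show k + 1 + 1 = k + 2 by ring, A k (by omega)]
      simpa using iterate_ne_of_lt_minimalPeriod (f := π) (x := u) (i := 0) (k := i + k + 1)
        (by omega) (by omega)

variable [Finite X]

/-- Adding an edge between two different faces merges them. -/
theorem minimalPeriod_ins_mul_swap_of_not_sameCycle {π : Perm X} {s t : X}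
    (h : ¬ SameCycle π s t) :
    Function.minimalPeriod (ins π s * swap none (some t)) (some s) =
      Function.minimalPeriod π s + Function.minimalPeriod π t + 1 := by
  set Φ := ins π s * swap none (some t) with hΦ
  have hst : s ≠ t := fun h' => h (h' ▸ SameCycle.refl π s)
  have h1 : Φ (some s) = none := by
    rw [hΦ, Perm.mul_apply, swap_apply_of_ne_of_ne (by simp) (by simpa using hst), ins_some_self]
  have h2 : Φ none = some (π t) := by
    rw [hΦ, Perm.mul_apply, swap_apply_left, ins_some_of_ne _ hst.symm]
  have h3 : Φ (some t) = some (π s) := by simp [hΦ]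
  have h4 : ∀ x, x ≠ s → x ≠ t → Φ (some x) = some (π x) := fun x hs ht => by
    rw [hΦ, Perm.mul_apply, swap_apply_of_ne_of_ne (by simp) (by simpa using ht),
      ins_some_of_ne _ hs]
  set d₁ := Function.minimalPeriod π s
  set d₂ := Function.minimalPeriod π t
  have hd₁ : 0 < d₁ := minimalPeriod_perm_pos π s
  have hd₂ : 0 < d₂ := minimalPeriod_perm_pos π t
  have hts : ∀ k, π^[k] t ≠ s := fun k hk => h (hk ▸ sameCycle_iterate π t k).symm
  have hst' : ∀ k, π^[k] s ≠ t := fun k hk => h (hk ▸ sameCycle_iterate π s k)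
  have A : ∀ k, k < d₂ → Φ^[k + 2] (some s) = some (π^[k + 1] t) := by
    intro k
    induction k with
    | zero => intro _; simp [h1, h2]
    | succ k ih =>
      intro hk
      rw [Function.iterate_succ_apply', ih (by omega), h4 _ (hts _), ← Function.iterate_succ_apply' π]
      exact iterate_ne_of_lt_minimalPeriod (i := 0) (by omega) hk
  have A' : Φ^[d₂ + 1] (some s) = some t := by
    have := A (d₂ - 1) (by omega)
    rw [show d₂ - 1 + 2 = d₂ + 1 by omega, Nat.sub_add_cancel hd₂] at this
    rw [this, Function.iterate_minimalPeriod]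
  have B : ∀ k, k < d₁ → Φ^[k + d₂ + 2] (some s) = some (π^[k + 1] s) := by
    intro k
    induction k with
    | zero => intro _; rw [zero_add, Function.iterate_succ_apply', A', h3]; rfl
    | succ k ih =>
      intro hk
      rw [show k + 1 + d₂ + 2 = (k + d₂ + 2) + 1 by ring, Function.iterate_succ_apply',
        ih (by omega), h4 _ _ (hst' _), ← Function.iterate_succ_apply' π]
      exact iterate_ne_of_lt_minimalPeriod (i := 0) (by omega) hk
  apply minimalPeriod_eq_of_forall (by omega)
  · have := B (d₁ - 1) (by omega)
    rw [show d₁ - 1 + d₂ + 2 = d₁ + d₂ + 1 by omega, Nat.sub_add_cancel hd₁] at this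
    rw [this, Function.iterate_minimalPeriod]
  · intro k hk hkd
    rcases k with _ | _ | k
    · omega
    · simp [h1]
    rcases lt_or_ge k d₂ with hk2 | hk2
    · rw [A k hk2]
      simpa using hts (k + 1)
    · obtain ⟨j, rfl⟩ := Nat.exists_eq_add_of_le' hk2
      rw [show j + d₂ + 1 + 1 = j + d₂ + 2 by ring, B j (by omega)]
      simpa using iterate_ne_of_lt_minimalPeriod (f := π) (x := s) (i := 0) (k := j + 1)
        (by omega) (by omega)

end Periods

section StubMaps

variable {X Y : Type*}

/-! ### Planar maps rooted at a stub

A rooted map with `n` edges is encoded by two permutations of a set of `2 * n + 1` darts, one of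
which, the stub `s`, is not part of an edge and marks the root corner. -/

theorem classCount_eq_one_iff [Nonempty X] {r : Setoid X} :
    classCount r = 1 ↔ ∀ x y, r x y := by
  rw [classCount, Nat.card_eq_one_iff_unique]
  constructor
  · rintro ⟨h, -⟩ x y
    exact Quotient.exact (h.elim ⟦x⟧ ⟦y⟧)
  · intro h
    refine ⟨⟨fun a b => ?_⟩, ‹Nonempty X›.map (Quotient.mk r)⟩
    induction a using Quotient.inductionOn
    induction b using Quotient.inductionOn
    exact Quotient.sound (h _ _)

theorem classCount_pos [Finite X] [Nonempty X] (r : Setoid X) : 0 < classCount r := by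
  have : Nonempty (Quotient r) := ‹Nonempty X›.map (Quotient.mk r)
  exact Nat.card_pos

/-- `(σ, α)` is a connected planar map whose only half-edge is the stub `s`. -/
structure IsStubMap (s : X) (σ α : Perm X) : Prop where
  invol : ∀ x, α (α x) = x
  fixed : ∀ x, α x = x ↔ x = s
  conn : classCount (orb σ α) = 1
  genus : cycleCount σ + cycleCount α + cycleCount (σ * α) = Nat.card X + 2

/-- `(σ, α)` is a map with exactly two stubs `s` and `t`. -/
structure HasStubs (s t : X) (α : Perm X) : Prop where
  invol : ∀ x, α (α x) = x
  fixed : ∀ x, α x = x ↔ x = s ∨ x = t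

/-- A connected planar map with two stubs, both lying in the same face. -/
structure IsFaceMap (s t : X) (σ α : Perm X) : Prop extends HasStubs s t α where
  conn : classCount (orb σ α) = 1
  genus : cycleCount σ + cycleCount α + cycleCount (σ * α) = Nat.card X + 2
  face : SameCycle (σ * α) s t

/-- A pair of connected planar maps with one stub each. -/
structure IsMapPair (s t : X) (σ α : Perm X) : Prop extends HasStubs s t α where
  conn : classCount (orb σ α) = 2
  genus : cycleCount σ + cycleCount α + cycleCount (σ * α) = Nat.card X + 4
  sep : ¬ orb σ α s t

theorem IsMapPair.not_sameCycle {s t : X} {σ α : Perm X} (h : IsMapPair s t σ α) :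
    ¬ SameCycle (σ * α) s t := fun h' => h.sep (cyc_mul_le_orb σ α h')

theorem IsStubMap.eq_of_apply_eq {s : X} {σ α : Perm X} (h : IsStubMap s σ α) (hs : σ s = s)
    (x : X) : x = s := by
  have : Nonempty X := ⟨s⟩
  have h1 : orb σ α ≤ Setoid.ker (fun x => x = s) := by
    refine orb_le_iff.2 ⟨fun x => ?_, fun x => ?_⟩ <;> simp only [Setoid.ker_def, eq_iff_iff]
    · constructor
      · rintro rfl; exact hs
      · intro h; exact σ.injective (h.trans hs.symm)
    · have hs := (h.fixed s).2 rfl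
      constructor
      · rintro rfl; exact hs
      · intro h; exact α.injective (h.trans hs.symm)
  have h2 := h1 (classCount_eq_one_iff.1 h.conn s x)
  simpa [Setoid.ker_def] using h2

theorem isStubMap_permCongr_iff (e : X ≃ Y) {s : X} {σ α : Perm X} :
    IsStubMap (e s) (e.permCongr σ) (e.permCongr α) ↔ IsStubMap s σ α := by
  have h1 : (∀ y, e.permCongr α (e.permCongr α y) = y) ↔ ∀ x, α (α x) = x := by
    rw [← e.forall_congr_right]; simp [Equiv.permCongr_apply]
  have h2 : (∀ y, e.permCongr α y = y ↔ y = e s) ↔ ∀ x, α x = x ↔ x = s := by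
    rw [← e.forall_congr_right]; simp [Equiv.permCongr_apply]
  constructor
  · rintro ⟨a, b, c, d⟩
    refine ⟨h1.1 a, h2.1 b, ?_, ?_⟩
    · rwa [orb_permCongr, classCount_comap_symm] at c
    · rwa [permCongr_mul', cycleCount_permCongr, cycleCount_permCongr, cycleCount_permCongr,
        ← Nat.card_congr e] at d
  · rintro ⟨a, b, c, d⟩
    refine ⟨h1.2 a, h2.2 b, ?_, ?_⟩
    · rwa [orb_permCongr, classCount_comap_symm]
    · rwa [permCongr_mul', cycleCount_permCongr, cycleCount_permCongr, cycleCount_permCongr,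
        ← Nat.card_congr e]

theorem isMapPair_permCongr_iff (e : X ≃ Y) {s t : X} {σ α : Perm X} :
    IsMapPair (e s) (e t) (e.permCongr σ) (e.permCongr α) ↔ IsMapPair s t σ α := by
  have h1 : (∀ y, e.permCongr α (e.permCongr α y) = y) ↔ ∀ x, α (α x) = x := by
    rw [← e.forall_congr_right]; simp [Equiv.permCongr_apply]
  have h2 : (∀ y, e.permCongr α y = y ↔ y = e s ∨ y = e t) ↔ ∀ x, α x = x ↔ x = s ∨ x = t := by
    rw [← e.forall_congr_right]; simp [Equiv.permCongr_apply]
  have h3 : orb (e.permCongr σ) (e.permCongr α) (e s) (e t) ↔ orb σ α s t := by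
    rw [orb_permCongr, Setoid.comap_rel, e.symm_apply_apply, e.symm_apply_apply]
  constructor
  · rintro ⟨⟨a, b⟩, c, d, f⟩
    refine ⟨⟨h1.1 a, h2.1 b⟩, ?_, ?_, fun h => f (h3.2 h)⟩
    · rwa [orb_permCongr, classCount_comap_symm] at c
    · rwa [permCongr_mul', cycleCount_permCongr, cycleCount_permCongr, cycleCount_permCongr,
        ← Nat.card_congr e] at d
  · rintro ⟨⟨a, b⟩, c, d, f⟩
    refine ⟨⟨h1.2 a, h2.2 b⟩, ?_, ?_, fun h => f (h3.1 h)⟩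
    · rwa [orb_permCongr, classCount_comap_symm]
    · rwa [permCongr_mul', cycleCount_permCongr, cycleCount_permCongr, cycleCount_permCongr,
        ← Nat.card_congr e]

theorem isMapPair_sumCongr_iff [Finite X] [Finite Y] {s : X} {t : Y} {σ α : Perm X}
    {σ' α' : Perm Y} :
    IsMapPair (.inl s) (.inr t) (Perm.sumCongr σ σ') (Perm.sumCongr α α') ↔
      IsStubMap s σ α ∧ IsStubMap t σ' α' := by
  have : Nonempty X := ⟨s⟩
  have : Nonempty Y := ⟨t⟩
  have p1 := classCount_pos (orb σ α)
  have p2 := classCount_pos (orb σ' α')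
  have g1 := cycleCount_add_le σ α
  have g2 := cycleCount_add_le σ' α'
  have hm : Perm.sumCongr σ σ' * Perm.sumCongr α α' = Perm.sumCongr (σ * α) (σ' * α') :=
    Perm.sumCongr_mul ..
  constructor
  · rintro ⟨⟨a, b⟩, c, d, -⟩
    rw [orb_sumCongr, classCount_sumSetoid] at c
    rw [hm, cycleCount_sumCongr, cycleCount_sumCongr, cycleCount_sumCongr, Nat.card_sum] at d
    refine ⟨⟨fun x => ?_, fun x => ?_, by omega, by omega⟩,
      ⟨fun x => ?_, fun x => ?_, by omega, by omega⟩⟩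
    · simpa using a (.inl x)
    · simpa using b (.inl x)
    · simpa using a (.inr x)
    · simpa using b (.inr x)
  · rintro ⟨⟨a, b, c, d⟩, ⟨a', b', c', d'⟩⟩
    refine ⟨⟨?_, ?_⟩, ?_, ?_, ?_⟩
    · rintro (x | x) <;> simp [a, a']
    · rintro (x | x) <;> simp [b, b']
    · rw [orb_sumCongr, classCount_sumSetoid, c, c']
    · rw [hm, cycleCount_sumCongr, cycleCount_sumCongr, cycleCount_sumCongr, Nat.card_sum]
      omega
    · rw [orb_sumCongr]
      exact not_sumSetoid_inl_inr

variable [DecidableEq X]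

theorem hasStubs_of_ins {s t : X} {α : Perm X} (hst : s ≠ t) :
    ((∀ x, ins α t (ins α t x) = x) ∧ (∀ x, ins α t x = x ↔ x = some s)) ↔ HasStubs s t α := by
  constructor
  · rintro ⟨a, b⟩
    have ht : α t = t := by
      have := a none
      rw [ins_none] at this
      by_contra h
      rw [ins_some_of_ne _ h] at this
      cases this
    have hne : ∀ x, x ≠ t → α x ≠ t := fun x hx h => hx (α.injective (h.trans ht.symm))
    refine ⟨fun x => ?_, fun x => ?_⟩
    · by_cases hx : x = t
      · rw [hx, ht, ht]
      · have := a (some x)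
        rwa [ins_some_of_ne _ hx, ins_some_of_ne _ (hne x hx), Option.some.injEq] at this
    · by_cases hx : x = t
      · simp [hx, ht]
      · have := b (some x)
        rw [ins_some_of_ne _ hx] at this
        simpa [hx] using this
  · rintro ⟨a, b⟩
    have ht : α t = t := (b t).2 (.inr rfl)
    have hne : ∀ x, x ≠ t → α x ≠ t := fun x hx h => hx (α.injective (h.trans ht.symm))
    constructor
    · rintro (_ | x)
      · rw [ins_none, ht, ins_some_self]
      · by_cases hx : x = t
        · rw [hx, ins_some_self, ins_none, ht]
        · rw [ins_some_of_ne _ hx, ins_some_of_ne _ (hne x hx), a]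
    · rintro (_ | x)
      · simp
      · by_cases hx : x = t
        · simp [hx, hst.symm]
        · rw [ins_some_of_ne _ hx]
          simpa [hx] using b x

variable [Finite X]

/-- Deleting the root edge of a planar map, but keeping its second dart as a stub. -/
theorem isStubMap_ins_ins_iff {s t : X} {σ α : Perm X} (hst : s ≠ t) :
    IsStubMap (some s) (ins σ s) (ins α t) ↔ IsFaceMap s t σ α ∨ IsMapPair s t σ α := by
  have hgen := cycleCount_add_le σ α
  have : Nonempty X := ⟨s⟩
  constructor
  · rintro ⟨a, b, c, d⟩
    have hs := (hasStubs_of_ins hst).1 ⟨a, b⟩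
    have hαs : α s = s := (hs.fixed s).2 (.inl rfl)
    rw [cycleCount_ins, cycleCount_ins, Finite.card_option] at d
    by_cases h : orb σ α s t
    · rw [classCount_orb_ins_ins_of_rel h] at c
      by_cases hf : SameCycle (σ * α) s t
      · rw [cycleCount_ins_mul_ins_of_sameCycle hαs hf] at d
        exact .inl ⟨hs, c, by omega, hf⟩
      · have := cycleCount_ins_mul_ins_of_not_sameCycle hαs hf
        omega
    · have h1 := classCount_orb_ins_ins_of_not_rel h
      have h2 := cycleCount_ins_mul_ins_of_not_sameCycle hαs fun h' => h (cyc_mul_le_orb σ α h')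
      exact .inr ⟨hs, by omega, by omega, h⟩
  · rintro (h | h)
    · obtain ⟨a, b⟩ := (hasStubs_of_ins hst).2 h.toHasStubs
      have hαs : α s = s := (h.fixed s).2 (.inl rfl)
      have hr : orb σ α s t := cyc_mul_le_orb σ α h.face
      refine ⟨a, b, by rw [classCount_orb_ins_ins_of_rel hr, h.conn], ?_⟩
      have := h.genus
      rw [cycleCount_ins, cycleCount_ins, cycleCount_ins_mul_ins_of_sameCycle hαs h.face,
        Finite.card_option]
      omega
    · obtain ⟨a, b⟩ := (hasStubs_of_ins hst).2 h.toHasStubs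
      have hαs : α s = s := (h.fixed s).2 (.inl rfl)
      have h1 := classCount_orb_ins_ins_of_not_rel h.sep
      have h2 := cycleCount_ins_mul_ins_of_not_sameCycle hαs h.not_sameCycle
      have h3 := h.conn
      have h4 := h.genus
      refine ⟨a, b, by omega, ?_⟩
      rw [cycleCount_ins, cycleCount_ins, Finite.card_option]
      omega

/-- Forgetting the second stub of a map with two stubs in the same face. -/
theorem isFaceMap_ins_iff {u y : X} {σ α : Perm X} :
    IsFaceMap (some u) none (ins σ (α y)) (optionCongr α) ↔
      IsStubMap u σ α ∧ SameCycle (σ * α) u y := by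
  have hf : SameCycle (ins σ (α y) * optionCongr α) (some u) none ↔ SameCycle (σ * α) u y := by
    rw [ins_mul_optionCongr, ← cyc_apply, cyc_ins, Setoid.comm', insSetoid_none, Setoid.comm']
    rfl
  have hinv : (∀ x, optionCongr α (optionCongr α x) = x) ↔ ∀ x, α (α x) = x := by
    rw [Option.forall]; simp
  have hfix : (∀ x, optionCongr α x = x ↔ x = some u ∨ x = none) ↔ ∀ x, α x = x ↔ x = u := by
    rw [Option.forall]; simp
  constructor
  · rintro ⟨⟨a, b⟩, c, d, f⟩
    rw [orb_ins_optionCongr, classCount_insSetoid] at c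
    rw [ins_mul_optionCongr, cycleCount_ins, cycleCount_ins, cycleCount_optionCongr,
      Finite.card_option] at d
    exact ⟨⟨hinv.1 a, hfix.1 b, c, by omega⟩, hf.1 f⟩
  · rintro ⟨⟨a, b, c, d⟩, f⟩
    refine ⟨⟨hinv.2 a, hfix.2 b⟩, ?_, ?_, hf.2 f⟩
    · rw [orb_ins_optionCongr, classCount_insSetoid, c]
    · rw [ins_mul_optionCongr, cycleCount_ins, cycleCount_ins, cycleCount_optionCongr,
        Finite.card_option]
      omega

end StubMaps

section Counting

variable {A B C : Type*}

/-! ### Counting tools -/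

theorem card_eq_sum_fiber [Finite A] [DecidableEq C] (P : A → Prop) (f : A → C) (t : Finset C)
    (h : ∀ a, P a → f a ∈ t) :
    Nat.card {a // P a} = ∑ c ∈ t, Nat.card {a // P a ∧ f a = c} := by
  classical
  have := Fintype.ofFinite A
  simp only [Nat.card_eq_fintype_card, Fintype.card_subtype]
  rw [Finset.card_eq_sum_card_fiberwise (f := f) (t := t) (by simpa [Set.MapsTo] using h)]
  simp only [Finset.filter_filter]

theorem card_subtype_of_injective {P : A → Prop} {Q : B → Prop} (f : A → B)
    (hf : ∀ a a', P a → P a' → f a = f a' → a = a') (h : ∀ b, Q b ↔ ∃ a, P a ∧ f a = b) :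
    Nat.card {b // Q b} = Nat.card {a // P a} := by
  symm
  refine Nat.card_congr (Equiv.ofBijective (fun a => ⟨f a.1, (h _).2 ⟨a.1, a.2, rfl⟩⟩) ⟨?_, ?_⟩)
  · rintro ⟨a, ha⟩ ⟨a', ha'⟩ haa
    exact Subtype.ext (hf a a' ha ha' (congrArg Subtype.val haa))
  · rintro ⟨b, hb⟩
    obtain ⟨a, ha, rfl⟩ := (h b).1 hb
    exact ⟨⟨a, ha⟩, rfl⟩

theorem card_subtype_or [Finite A] {P Q : A → Prop} (h : ∀ a, P a → ¬ Q a) :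
    Nat.card {a // P a ∨ Q a} = Nat.card {a // P a} + Nat.card {a // Q a} := by
  classical
  rw [← Nat.card_sum]
  exact Nat.card_congr (subtypeOrEquiv P Q (Pi.disjoint_iff.2 fun a =>
    Prop.disjoint_iff.2 (by have := h a; tauto)))

end Counting

section StubCount

variable {X Y : Type*}

/-- The number of planar maps with stub `s` and root face of degree `d`. -/
noncomputable def stubs (s : X) (d : ℕ) : ℕ :=
  Nat.card {p : Perm X × Perm X //
    IsStubMap s p.1 p.2 ∧ Function.minimalPeriod (p.1 * p.2 : Perm X) s = d}

/-- The number of planar maps on `m` darts and one stub, with root face of degree `d`. -/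
noncomputable def stubCount (m d : ℕ) : ℕ := stubs (0 : Fin (m + 1)) d

theorem stubs_equiv (e : X ≃ Y) (s : X) (d : ℕ) : stubs (e s) d = stubs s d := by
  refine (Nat.card_congr ((e.permCongr.prodCongr e.permCongr).subtypeEquiv fun p => ?_)).symm
  have := isStubMap_permCongr_iff e (s := s) (σ := p.1) (α := p.2)
  have h2 := minimalPeriod_permCongr e (p.1 * p.2) s
  rw [← permCongr_mul'] at h2
  simp only [Equiv.prodCongr_apply, Prod.map_fst, Prod.map_snd]
  rw [this, h2]

theorem stubs_eq_stubCount {m : ℕ} (h : Nat.card X = m + 1) (s : X) (d : ℕ) :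
    stubs s d = stubCount m d := by
  have : Finite X := Nat.finite_of_card_ne_zero (by omega)
  have e := Finite.equivFinOfCardEq h
  have h1 := stubs_equiv (e.trans (swap (e s) 0)) s d
  rw [← h1]
  simp [stubCount]

theorem stubCount_zero_right (m : ℕ) : stubCount m 0 = 0 := by
  have : IsEmpty {p : Perm (Fin (m + 1)) × Perm (Fin (m + 1)) //
    IsStubMap 0 p.1 p.2 ∧ Function.minimalPeriod (p.1 * p.2 : Perm _) 0 = 0} :=
    ⟨fun p => (minimalPeriod_perm_pos _ _).ne' p.2.2⟩
  exact Nat.card_of_isEmpty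

theorem minimalPeriod_le_card [Finite X] (π : Perm X) (s : X) :
    Function.minimalPeriod π s ≤ Nat.card X := by
  have := Fintype.ofFinite X
  rw [Nat.card_eq_fintype_card]
  exact Function.minimalPeriod_le_card

theorem stubCount_eq_zero {m d : ℕ} (h : m + 2 ≤ d) : stubCount m d = 0 := by
  have : IsEmpty {p : Perm (Fin (m + 1)) × Perm (Fin (m + 1)) //
    IsStubMap 0 p.1 p.2 ∧ Function.minimalPeriod (p.1 * p.2 : Perm _) 0 = d} := by
    refine ⟨fun p => ?_⟩
    have := minimalPeriod_le_card (p.1.1 * p.1.2) (0 : Fin (m + 1))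
    rw [p.2.2, Nat.card_eq_fintype_card, Fintype.card_fin] at this
    omega
  exact Nat.card_of_isEmpty

theorem isStubMap_one_of_unique [Unique X] (s : X) : IsStubMap s (1 : Perm X) 1 := by
  refine ⟨fun x => rfl, fun x => by simp [Subsingleton.elim x s],
    classCount_eq_one_iff.2 fun x y => ?_, ?_⟩
  · rw [Subsingleton.elim x y]
  · simp [cycleCount_one]

theorem stubCount_zero_left (d : ℕ) : stubCount 0 d = if d = 1 then 1 else 0 := by
  have h : ∀ p : Perm (Fin 1) × Perm (Fin 1), IsStubMap 0 p.1 p.2 ∧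
      Function.minimalPeriod (p.1 * p.2 : Perm (Fin 1)) 0 = d ↔ d = 1 := fun p => by
    rw [Subsingleton.elim p (1, 1)]
    simp [isStubMap_one_of_unique, -mul_one, eq_comm]
  have : stubCount 0 d = _ := Nat.card_congr (Equiv.subtypeEquivRight h)
  rw [this]
  split_ifs with hd
  · simp [hd]
  · simp [hd]

theorem stubCount_one_left (d : ℕ) : stubCount 1 d = 0 := by
  have : IsEmpty {p : Perm (Fin 2) × Perm (Fin 2) //
    IsStubMap 0 p.1 p.2 ∧ Function.minimalPeriod (p.1 * p.2 : Perm _) 0 = d} := by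
    refine ⟨fun p => ?_⟩
    have h0 := (p.2.1.fixed 0).2 rfl
    have h1 := p.2.1.fixed 1
    have : p.1.2 1 ≠ p.1.2 0 := p.1.2.injective.ne (by decide)
    rw [h0] at this
    simp only [show (1 : Fin 2) ≠ 0 by decide, iff_false] at h1
    omega
  exact Nat.card_of_isEmpty

theorem IsStubMap.apply_ne {s : X} {σ α : Perm X} (h : IsStubMap s σ α) [Nontrivial X] :
    σ s ≠ s := fun hs => by
  obtain ⟨x, hx⟩ := exists_ne s
  exact hx (h.eq_of_apply_eq hs x)

theorem exists_perm_of_ne [DecidableEq Y] {s a b a' b' : Y} (ha : a ≠ s) (hb : b ≠ s) (hab : a ≠ b)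
    (ha' : a' ≠ s) (hb' : b' ≠ s) (hab' : a' ≠ b') :
    ∃ e : Perm Y, e s = s ∧ e a = a' ∧ e b = b' := by
  set b₁ := swap a a' b with hb₁
  have h1 : b₁ ≠ a' := fun h => by
    rw [hb₁, swap_apply_eq_iff, swap_apply_right] at h
    exact hab h.symm
  have h2 : b₁ ≠ s := fun h => by
    rw [hb₁, swap_apply_eq_iff, swap_apply_of_ne_of_ne ha.symm ha'.symm] at h
    exact hb h
  refine ⟨swap b₁ b' * swap a a', ?_, ?_, ?_⟩
  · rw [Perm.mul_apply, swap_apply_of_ne_of_ne ha.symm ha'.symm,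
      swap_apply_of_ne_of_ne h2.symm hb'.symm]
  · rw [Perm.mul_apply, swap_apply_left, swap_apply_of_ne_of_ne h1.symm hab']
  · rw [Perm.mul_apply, ← hb₁, swap_apply_left]

/-- The darts of the root edge may be relabelled arbitrarily. -/
theorem stubs_eq_mul_card [Finite Y] [DecidableEq Y] {m : ℕ} (hY : Nat.card Y = m + 3) {s a b : Y}
    (ha : a ≠ s) (hb : b ≠ s) (hab : a ≠ b) (d : ℕ) :
    stubs s d = (m + 2) * (m + 1) * Nat.card {p : Perm Y × Perm Y //
      (IsStubMap s p.1 p.2 ∧ Function.minimalPeriod (p.1 * p.2 : Perm Y) s = d) ∧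
        (p.1 s, p.2 (p.1 s)) = (a, b)} := by
  have := Fintype.ofFinite Y
  rw [Nat.card_eq_fintype_card] at hY
  have : Nontrivial Y := ⟨a, s, ha⟩
  have hcard : (Finset.univ.erase s).offDiag.card = (m + 2) * (m + 1) := by
    rw [Finset.offDiag_card, Finset.card_erase_of_mem (Finset.mem_univ _), Finset.card_univ, hY,
      show m + 3 - 1 = m + 2 by omega, ← Nat.mul_sub_one]
    rfl
  rw [stubs, card_eq_sum_fiber _ (fun p : Perm Y × Perm Y => (p.1 s, p.2 (p.1 s)))
    (Finset.univ.erase s).offDiag, ← hcard, ← smul_eq_mul, ← Finset.sum_const]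
  · refine Finset.sum_congr rfl fun c hc => ?_
    obtain ⟨a', b'⟩ := c
    simp only [Finset.mem_offDiag, Finset.mem_erase, Finset.mem_univ, and_true] at hc
    obtain ⟨e, hes, hea, heb⟩ := exists_perm_of_ne hc.1 hc.2.1 hc.2.2 ha hb hab
    refine Nat.card_congr ((e.permCongr.prodCongr e.permCongr).subtypeEquiv fun p => ?_)
    have h1 := isStubMap_permCongr_iff e (s := s) (σ := p.1) (α := p.2)
    have h2 := minimalPeriod_permCongr e (p.1 * p.2) s
    have hes' : e.symm s = s := by rw [Equiv.symm_apply_eq, hes]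
    rw [← permCongr_mul'] at h2
    simp only [Equiv.prodCongr_apply, Prod.map_fst, Prod.map_snd, Equiv.permCongr_apply,
      Prod.mk.injEq, Equiv.symm_apply_apply, hes']
    rw [hes] at h1 h2
    rw [h1, h2, ← hea, ← heb, e.apply_eq_iff_eq, e.apply_eq_iff_eq]
  · rintro p ⟨hp, -⟩
    simp only [Finset.mem_offDiag, Finset.mem_erase, Finset.mem_univ, and_true]
    have hα := (hp.fixed s).2 rfl
    refine ⟨hp.apply_ne, fun h => hp.apply_ne (p.2.injective (h.trans hα.symm)),
      fun h => hp.apply_ne ((hp.fixed _).1 h.symm)⟩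

end StubCount

section Recursion

variable {X Z : Type*} [DecidableEq X] [Finite X] [DecidableEq Z] [Finite Z]

/-- Deletion of the root edge. -/
theorem card_stubMap_eq_add {s t : X} (hst : s ≠ t) (d : ℕ) :
    Nat.card {p : Perm (Option X) × Perm (Option X) //
      (IsStubMap (some s) p.1 p.2 ∧
        Function.minimalPeriod (p.1 * p.2 : Perm (Option X)) (some s) = d) ∧
        (p.1 (some s), p.2 (p.1 (some s))) = (none, some t)} =
    Nat.card {p : Perm X × Perm X // IsFaceMap s t p.1 p.2 ∧ Function.minimalPeriod
        (ins (p.1 * p.2) s * swap none (some t) : Perm (Option X)) (some s) = d} +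
    Nat.card {p : Perm X × Perm X // IsMapPair s t p.1 p.2 ∧ Function.minimalPeriod
        (ins (p.1 * p.2) s * swap none (some t) : Perm (Option X)) (some s) = d} := by
  rw [← card_subtype_or (fun p h h' => by have := h.1.conn; have := h'.1.conn; omega)]
  refine card_subtype_of_injective (fun p => (ins p.1 s, ins p.2 t)) ?_ ?_
  · rintro p p' - - h
    exact Prod.ext (ins_injective s (congrArg Prod.fst h)) (ins_injective t (congrArg Prod.snd h))
  · rintro ⟨σ, α⟩
    constructor
    · rintro ⟨⟨h, hd⟩, h'⟩
      simp only [Prod.mk.injEq] at h'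
      obtain ⟨σ', rfl⟩ := exists_eq_ins h'.1
      rw [h'.1] at h'
      obtain ⟨α', rfl⟩ : ∃ α', α = ins α' t :=
        exists_eq_ins (by have := h.invol none; rwa [h'.2] at this)
      refine ⟨(σ', α'), ?_, rfl⟩
      have hh := (isStubMap_ins_ins_iff hst).1 h
      have hα : α' s = s := by
        rcases hh with hh | hh
        · exact (hh.fixed s).2 (.inl rfl)
        · exact (hh.fixed s).2 (.inl rfl)
      dsimp only at hd
      rw [ins_mul_ins _ _ hα] at hd
      exact hh.imp (⟨·, hd⟩) (⟨·, hd⟩)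
    · rintro ⟨⟨σ', α'⟩, hh, h⟩
      obtain ⟨rfl, rfl⟩ := Prod.mk.inj h
      obtain ⟨hh, hd⟩ := or_and_right.2 hh
      have hs : HasStubs s t α' := hh.elim (·.toHasStubs) (·.toHasStubs)
      refine ⟨⟨(isStubMap_ins_ins_iff hst).2 hh, ?_⟩, ?_⟩
      · dsimp only
        rw [ins_mul_ins _ _ ((hs.fixed s).2 (.inl rfl))]
        exact hd
      · simp [(hs.fixed t).2 (.inr rfl)]

theorem card_faceMap {m : ℕ} (hZ : Nat.card Z = m + 1) (u : Z) (d : ℕ) :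
    Nat.card {p : Perm (Option Z) × Perm (Option Z) // IsFaceMap (some u) none p.1 p.2 ∧
      Function.minimalPeriod (ins (p.1 * p.2) (some u) * swap none (some none) :
        Perm (Option (Option Z))) (some (some u)) = d} =
    ∑ d' ∈ Finset.range (m + 2), if 2 ≤ d ∧ d ≤ d' + 1 then stubCount m d' else 0 := by
  trans Nat.card {p : Perm Z × Perm Z // IsStubMap u p.1 p.2 ∧ 2 ≤ d ∧
    d ≤ Function.minimalPeriod (p.1 * p.2 : Perm Z) u + 1}
  · refine card_subtype_of_injective (fun p => (ins p.1 (p.2 ((p.1 * p.2 : Perm Z)^[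
      Function.minimalPeriod (p.1 * p.2 : Perm Z) u + 1 - d] u)), optionCongr p.2)) ?_ ?_
    · rintro ⟨σ, α⟩ ⟨σ', α'⟩ - - h
      obtain ⟨h1, h2⟩ := Prod.mk.inj h
      obtain rfl := optionCongr_injective h2
      dsimp only at h1
      set y := α ((σ * α : Perm Z)^[Function.minimalPeriod (σ * α : Perm Z) u + 1 - d] u)
      set y' := α ((σ' * α : Perm Z)^[Function.minimalPeriod (σ' * α : Perm Z) u + 1 - d] u)
      have h3 : ins σ' y' (some y) = none := by rw [← h1, ins_some_self]
      have h4 : y = y' := by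
        by_contra hne
        rw [ins_some_of_ne _ hne] at h3
        cases h3
      rw [h4] at h1
      rw [ins_injective _ h1]
    · rintro ⟨σ, α⟩
      constructor
      · rintro ⟨h, hd⟩
        dsimp only at h hd
        obtain ⟨α', rfl⟩ : ∃ α', α = optionCongr α' :=
          ⟨_, (optionCongr_removeNone_of_none ((h.fixed none).2 (.inr rfl))).symm⟩
        obtain ⟨w, hw⟩ := σ.surjective none
        rcases w with _ | w
        · have h1 := h.face.symm
          have : (σ * optionCongr α' : Perm _) none = none := hw
          cases h1.eq_of_left this
        obtain ⟨σ', rfl⟩ := exists_eq_ins hw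
        obtain ⟨y, rfl⟩ := α'.surjective w
        obtain ⟨h1, h2⟩ := isFaceMap_ins_iff.1 h
        obtain ⟨i, hi, rfl⟩ := SameCycle.exists_iterate_lt h2
        rw [ins_mul_optionCongr] at hd
        have h3 := minimalPeriod_ins_ins_mul_swap hi
        rw [hd] at h3
        refine ⟨(σ', α'), ⟨h1, by omega, by dsimp only; omega⟩, ?_⟩
        dsimp only
        rw [show Function.minimalPeriod (σ' * α' : Perm Z) u + 1 - d = i by omega]
      · rintro ⟨⟨σ', α'⟩, ⟨h1, h2, h3⟩, h⟩
        obtain ⟨rfl, rfl⟩ := Prod.mk.inj h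
        dsimp only at h1 h2 h3 ⊢
        have h4 := minimalPeriod_ins_ins_mul_swap (π := σ' * α') (u := u)
          (i := Function.minimalPeriod (σ' * α' : Perm Z) u + 1 - d) (by omega)
        refine ⟨isFaceMap_ins_iff.2 ⟨h1, sameCycle_iterate _ _ _⟩, ?_⟩
        rw [ins_mul_optionCongr]
        omega
  · rw [card_eq_sum_fiber _ (fun p : Perm Z × Perm Z => Function.minimalPeriod (p.1 * p.2 : Perm Z) u)
      (Finset.range (m + 2))]
    · refine Finset.sum_congr rfl fun d' _ => ?_
      split_ifs with hd
      · rw [← stubs_eq_stubCount hZ u]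
        refine Nat.card_congr (Equiv.subtypeEquivRight fun p => ?_)
        constructor
        · rintro ⟨⟨h, -⟩, h'⟩
          exact ⟨h, h'⟩
        · rintro ⟨h, h'⟩
          exact ⟨⟨h, hd.1, h' ▸ hd.2⟩, h'⟩
      · have : IsEmpty {p : Perm Z × Perm Z // (IsStubMap u p.1 p.2 ∧ 2 ≤ d ∧
            d ≤ Function.minimalPeriod (p.1 * p.2 : Perm Z) u + 1) ∧
            Function.minimalPeriod (p.1 * p.2 : Perm Z) u = d'} :=
          ⟨fun p => hd ⟨p.2.1.2.1, p.2.2 ▸ p.2.1.2.2⟩⟩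
        exact Nat.card_of_isEmpty
    · intro p _
      have := minimalPeriod_le_card (p.1 * p.2) u
      simp only [Finset.mem_range]
      omega

end Recursion

section MapPairs

variable {X : Type*} [DecidableEq X]

theorem minimalPeriod_subtypeCongr_left {A : Finset X} {s : X} (hs : s ∈ A)
    (σ : Perm {x // x ∈ A}) (σ' : Perm {x // x ∉ A}) :
    Function.minimalPeriod (σ.subtypeCongr σ') s = Function.minimalPeriod σ ⟨s, hs⟩ :=
  minimalPeriod_semiconj (i := Subtype.val) Subtype.val_injective
    (fun x => (Perm.subtypeCongr.left_apply_subtype σ σ' x).symm) ⟨s, hs⟩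

theorem minimalPeriod_subtypeCongr_right {A : Finset X} {t : X} (ht : t ∉ A)
    (σ : Perm {x // x ∈ A}) (σ' : Perm {x // x ∉ A}) :
    Function.minimalPeriod (σ.subtypeCongr σ') t = Function.minimalPeriod σ' ⟨t, ht⟩ :=
  minimalPeriod_semiconj (i := Subtype.val) Subtype.val_injective
    (fun x => (Perm.subtypeCongr.right_apply_subtype σ σ' x).symm) ⟨t, ht⟩

theorem subtypeCongr_mul {A : Finset X} (σ α : Perm {x // x ∈ A}) (σ' α' : Perm {x // x ∉ A}) :
    σ.subtypeCongr σ' * α.subtypeCongr α' = (σ * α).subtypeCongr (σ' * α') :=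
  (map_mul (Perm.subtypeCongrHom (· ∈ A)) (σ, σ') (α, α')).symm

theorem orb_subtypeCongr_iff {A : Finset X} {s : X} (hs : s ∈ A)
    {σ α : Perm {x // x ∈ A}} {σ' α' : Perm {x // x ∉ A}} (h : classCount (orb σ α) = 1) (x : X) :
    orb (σ.subtypeCongr σ') (α.subtypeCongr α') s x ↔ x ∈ A := by
  have : Nonempty {x // x ∈ A} := ⟨⟨s, hs⟩⟩
  have key : orb (σ.subtypeCongr σ') (α.subtypeCongr α') =
      (sumSetoid (orb σ α) (orb σ' α')).comap (Equiv.sumCompl (· ∈ A)).symm := by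
    rw [← orb_sumCongr, ← orb_permCongr]
    rfl
  rw [key, Setoid.comap_rel, Equiv.sumCompl_symm_apply_of_pos hs]
  by_cases hx : x ∈ A
  · rw [Equiv.sumCompl_symm_apply_of_pos hx, sumSetoid_inl]
    simpa [hx] using classCount_eq_one_iff.1 h _ _
  · rw [Equiv.sumCompl_symm_apply_of_neg hx]
    simpa [hx] using not_sumSetoid_inl_inr

theorem exists_eq_subtypeCongr {A : Finset X} {π : Perm X} (h : ∀ x, π x ∈ A ↔ x ∈ A) :
    ∃ (σ : Perm {x // x ∈ A}) (σ' : Perm {x // x ∉ A}), π = σ.subtypeCongr σ' := by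
  refine ⟨π.subtypePerm fun x => h x, π.subtypePerm fun x => not_congr (h x), ?_⟩
  ext x
  by_cases hx : x ∈ A
  · rw [Perm.subtypeCongr.left_apply _ _ hx, Perm.subtypePerm_apply]
  · rw [Perm.subtypeCongr.right_apply _ _ hx, Perm.subtypePerm_apply]

variable [Finite X]

theorem isMapPair_subtypeCongr_iff {A : Finset X} {s t : X} (hs : s ∈ A) (ht : t ∉ A)
    {σ α : Perm {x // x ∈ A}} {σ' α' : Perm {x // x ∉ A}} :
    IsMapPair s t (σ.subtypeCongr σ') (α.subtypeCongr α') ↔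
      IsStubMap ⟨s, hs⟩ σ α ∧ IsStubMap ⟨t, ht⟩ σ' α' := by
  rw [← isMapPair_sumCongr_iff, ← isMapPair_permCongr_iff (Equiv.sumCompl (· ∈ A))]
  rfl

/-- The pairs of maps in which the first map uses a prescribed set of darts. -/
theorem card_mapPair_fiber {A : Finset X} {s t : X} (hs : s ∈ A) (ht : t ∉ A) {a b : ℕ}
    (ha : A.card = a + 1) (hb : Nat.card X = a + b + 2) (d e : ℕ) :
    Nat.card {p : Perm X × Perm X // IsMapPair s t p.1 p.2 ∧ (∀ x, orb p.1 p.2 s x ↔ x ∈ A) ∧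
      Function.minimalPeriod (p.1 * p.2 : Perm X) s = d ∧
      Function.minimalPeriod (p.1 * p.2 : Perm X) t = e} = stubCount a d * stubCount b e := by
  have hA : Nat.card {x // x ∈ A} = a + 1 := by simp [ha]
  have hA' : Nat.card {x // x ∉ A} = b + 1 := by
    have := Nat.card_congr (Equiv.sumCompl (· ∈ A))
    rw [Nat.card_sum, hA] at this
    omega
  rw [← stubs_eq_stubCount hA ⟨s, hs⟩, ← stubs_eq_stubCount hA' ⟨t, ht⟩, stubs, stubs,
    ← Nat.card_prod, ← Nat.card_congr (Equiv.subtypeProdEquivProd (p := fun p :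
      Perm {x // x ∈ A} × Perm {x // x ∈ A} => IsStubMap ⟨s, hs⟩ p.1 p.2 ∧ _)
      (q := fun p : Perm {x // x ∉ A} × Perm {x // x ∉ A} => IsStubMap ⟨t, ht⟩ p.1 p.2 ∧ _))]
  refine card_subtype_of_injective
    (fun q => (q.1.1.subtypeCongr q.2.1, q.1.2.subtypeCongr q.2.2)) ?_ ?_
  · rintro ⟨⟨σ, α⟩, σ', α'⟩ ⟨⟨τ, β⟩, τ', β'⟩ - - h
    obtain ⟨h1, h2⟩ := Prod.mk.inj h
    have h3 := @Perm.subtypeCongrHom_injective _ (· ∈ A) _ (σ, σ') (τ, τ') h1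
    have h4 := @Perm.subtypeCongrHom_injective _ (· ∈ A) _ (α, α') (β, β') h2
    simp only [Prod.mk.injEq] at h3 h4 ⊢
    tauto
  · rintro ⟨σ, α⟩
    constructor
    · rintro ⟨h, hA, hd, he⟩
      dsimp only at h hA hd he
      obtain ⟨σ₁, σ₂, rfl⟩ := exists_eq_subtypeCongr (A := A) (π := σ) fun x => by
        rw [← hA, ← hA]
        exact ⟨fun h => Setoid.trans' _ h (Setoid.symm' _ (orb_rel_left _ _ _)),
          fun h => Setoid.trans' _ h (orb_rel_left _ _ _)⟩
      obtain ⟨α₁, α₂, rfl⟩ := exists_eq_subtypeCongr (A := A) (π := α) fun x => by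
        rw [← hA, ← hA]
        exact ⟨fun h => Setoid.trans' _ h (Setoid.symm' _ (orb_rel_right _ _ _)),
          fun h => Setoid.trans' _ h (orb_rel_right _ _ _)⟩
      rw [subtypeCongr_mul] at hd he
      rw [minimalPeriod_subtypeCongr_left hs] at hd
      rw [minimalPeriod_subtypeCongr_right ht] at he
      obtain ⟨h1, h2⟩ := (isMapPair_subtypeCongr_iff hs ht).1 h
      exact ⟨((σ₁, α₁), (σ₂, α₂)), ⟨⟨h1, hd⟩, ⟨h2, he⟩⟩, rfl⟩
    · rintro ⟨⟨⟨σ₁, α₁⟩, σ₂, α₂⟩, ⟨⟨h1, hd⟩, ⟨h2, he⟩⟩, h⟩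
      obtain ⟨rfl, rfl⟩ := Prod.mk.inj h
      dsimp only at h1 h2 hd he ⊢
      refine ⟨(isMapPair_subtypeCongr_iff hs ht).2 ⟨h1, h2⟩,
        orb_subtypeCongr_iff hs h1.conn, ?_, ?_⟩
      · rw [subtypeCongr_mul, minimalPeriod_subtypeCongr_left hs, hd]
      · rw [subtypeCongr_mul, minimalPeriod_subtypeCongr_right ht, he]

theorem card_mapPair {m : ℕ} (hX : Nat.card X = m + 2) {s t : X} (hst : s ≠ t) (d : ℕ) :
    Nat.card {p : Perm X × Perm X // IsMapPair s t p.1 p.2 ∧ Function.minimalPeriod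
        (ins (p.1 * p.2) s * swap none (some t) : Perm (Option X)) (some s) = d + 1} =
    ∑ j ∈ Finset.HasAntidiagonal.antidiagonal m, m.choose j.1 *
      ∑ e ∈ Finset.HasAntidiagonal.antidiagonal d, stubCount j.1 e.1 * stubCount j.2 e.2 := by
  classical
  have := Fintype.ofFinite X
  set T : Finset X := Finset.univ \ {s, t} with hT
  have hTc : T.card = m := by
    rw [hT, Finset.card_sdiff_of_subset (Finset.subset_univ _), Finset.card_univ,
      Finset.card_pair hst, ← Nat.card_eq_fintype_card, hX, Nat.add_sub_cancel]
  rw [card_eq_sum_fiber _ (fun p : Perm X × Perm X =>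
    (Finset.univ.filter fun x => x ≠ s ∧ orb p.1 p.2 s x,
      (Function.minimalPeriod (p.1 * p.2 : Perm X) s,
        Function.minimalPeriod (p.1 * p.2 : Perm X) t)))
    (T.powerset ×ˢ Finset.HasAntidiagonal.antidiagonal d), Finset.sum_product]
  · trans ∑ B ∈ T.powerset, ∑ e ∈ Finset.HasAntidiagonal.antidiagonal d,
      stubCount B.card e.1 * stubCount (m - B.card) e.2
    · refine Finset.sum_congr rfl fun B hB => Finset.sum_congr rfl fun e he => ?_
      rw [Finset.mem_powerset] at hB
      rw [Finset.HasAntidiagonal.mem_antidiagonal] at he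
      have hBm : B.card ≤ m := hTc ▸ Finset.card_le_card hB
      have hsB : s ∉ B := fun h => by simpa [hT] using hB h
      have htB : t ∉ B := fun h => by simpa [hT] using hB h
      rw [← card_mapPair_fiber (A := insert s B) (s := s) (t := t) (by simp)
        (by simp [htB, hst.symm]) (Finset.card_insert_of_notMem hsB) (by omega)]
      refine Nat.card_congr (Equiv.subtypeEquivRight fun p => ?_)
      have hset : (Finset.univ.filter fun x => x ≠ s ∧ orb p.1 p.2 s x) = B ↔
          ∀ x, orb p.1 p.2 s x ↔ x ∈ insert s B := by
        rw [Finset.ext_iff]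
        refine forall_congr' fun x => ?_
        by_cases hx : x = s
        · simp [hx, hsB]
        · simp [hx]
      rw [Prod.ext_iff, Prod.ext_iff, hset]
      constructor
      · rintro ⟨⟨h, -⟩, h'⟩
        exact ⟨h, h'⟩
      · rintro ⟨h, h'⟩
        refine ⟨⟨h, ?_⟩, h'⟩
        rw [minimalPeriod_ins_mul_swap_of_not_sameCycle h.not_sameCycle, h'.2.1, h'.2.2, he]
    · rw [Finset.sum_powerset_apply_card (fun k => ∑ e ∈ Finset.HasAntidiagonal.antidiagonal d,
        stubCount k e.1 * stubCount (m - k) e.2), hTc,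
        Finset.Nat.sum_antidiagonal_eq_sum_range_succ_mk]
      simp only [smul_eq_mul]
  · rintro p ⟨h, hd⟩
    rw [minimalPeriod_ins_mul_swap_of_not_sameCycle h.not_sameCycle] at hd
    rw [Finset.mem_product, Finset.mem_powerset, Finset.HasAntidiagonal.mem_antidiagonal]
    refine ⟨fun x hx => ?_, by dsimp only; omega⟩
    simp only [Finset.mem_filter, Finset.mem_univ, true_and] at hx
    simp only [hT, Finset.mem_sdiff, Finset.mem_univ, true_and, Finset.mem_insert,
      Finset.mem_singleton, not_or]
    exact ⟨hx.1, fun hxt => h.sep (hxt ▸ hx.2)⟩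

/-- Tutte's recursion. -/
theorem stubCount_add_two (m d : ℕ) :
    stubCount (m + 2) (d + 1) = (m + 2) * (m + 1) *
      ((∑ j ∈ Finset.HasAntidiagonal.antidiagonal m, m.choose j.1 *
        ∑ e ∈ Finset.HasAntidiagonal.antidiagonal d, stubCount j.1 e.1 * stubCount j.2 e.2) +
      ∑ d' ∈ Finset.range (m + 2), if 1 ≤ d ∧ d ≤ d' then stubCount m d' else 0) := by
  have hZ : Nat.card (Fin (m + 1)) = m + 1 := by simp
  have hX : Nat.card (Option (Fin (m + 1))) = m + 2 := by simp
  have hY : Nat.card (Option (Option (Fin (m + 1)))) = m + 3 := by simp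
  have hst : (some 0 : Option (Fin (m + 1))) ≠ none := by simp
  rw [← stubs_eq_stubCount hY (some (some 0)), stubs_eq_mul_card hY (a := none) (b := some none)
    (by simp) (by simp) (by simp), card_stubMap_eq_add hst, card_faceMap hZ,
    card_mapPair hX hst, add_comm (∑ d' ∈ _, _)]
  simp only [Nat.succ_le_succ_iff, show 2 = 1 + 1 from rfl]

end MapPairs

section Rooted

/-! ### From rooted maps to maps with a stub -/

theorem cycleCount_involution {X : Type*} [Finite X] {α : Perm X} (h : ∀ x, α (α x) = x)
    (h' : ∀ x, α x ≠ x) : cycleCount α * 2 = Nat.card X := by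
  classical
  have key : ∀ x y, cyc α x y ↔ y = x ∨ y = α x := by
    intro x y
    constructor
    · rintro ⟨i, rfl⟩
      have h2 : α ^ (2 : ℤ) = 1 := by
        ext x
        simpa [zpow_ofNat, pow_two] using h x
      rcases Int.even_or_odd' i with ⟨k, rfl | rfl⟩
      · left; rw [zpow_mul, h2, one_zpow, Perm.one_apply]
      · right; rw [zpow_add, zpow_mul, h2, one_zpow, one_mul, zpow_one]
    · rintro (rfl | rfl)
      · exact Setoid.refl' _ _
      · exact cyc_self_apply α x
  have hfib : ∀ q : Quotient (cyc α), Nat.card {x // Quotient.mk (cyc α) x = q} = 2 := by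
    intro q
    induction q using Quotient.inductionOn with | _ x
    have : ∀ y, Quotient.mk (cyc α) y = Quotient.mk (cyc α) x ↔
        y ∈ ({x, α x} : Finset X) := fun y => by
      rw [eq_comm, Quotient.eq, Finset.mem_insert, Finset.mem_singleton]
      exact key x y
    rw [Nat.card_congr (Equiv.subtypeEquivRight this), Nat.card_eq_fintype_card, Fintype.card_coe,
      Finset.card_pair (h' x).symm]
  have := Fintype.ofFinite (Quotient (cyc α))
  rw [← Nat.card_congr (Equiv.sigmaFiberEquiv (Quotient.mk (cyc α))), Nat.card_sigma,
    Finset.sum_congr rfl fun q _ => hfib q]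
  simp [cycleCount, classCount, Nat.card_eq_fintype_card]

theorem orbitCount_eq_cycleCount {m : ℕ} (π : Perm (Fin m)) : orbitCount π = cycleCount π := by
  refine Nat.card_congr (Quotient.congrRight fun x y => ?_)
  change x ∈ MulAction.orbit _ y ↔ SameCycle π x y
  rw [sameCycle_comm]
  constructor
  · rintro ⟨⟨g, i, rfl⟩, h⟩
    exact ⟨i, h⟩
  · rintro ⟨i, h⟩
    exact ⟨⟨π ^ i, i, rfl⟩, h⟩

theorem orb_iff_exists_mem_closure {X : Type*} {σ α : Perm X} {x y : X} :
    orb σ α x y ↔ ∃ g ∈ Subgroup.closure ({σ, α} : Set (Perm X)), g x = y := by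
  constructor
  · have : orb σ α ≤ MulAction.orbitRel (Subgroup.closure ({σ, α} : Set (Perm X))) X := by
      refine orb_le_iff.2 ⟨fun z => ?_, fun z => ?_⟩ <;> refine Setoid.symm' _ ?_
      · exact ⟨⟨σ, Subgroup.subset_closure (by simp)⟩, rfl⟩
      · exact ⟨⟨α, Subgroup.subset_closure (by simp)⟩, rfl⟩
    intro h
    obtain ⟨⟨g, hg⟩, h⟩ := Setoid.symm' _ (this h)
    exact ⟨g, hg, h⟩
  · rintro ⟨g, hg, rfl⟩
    induction hg using Subgroup.closure_induction generalizing x with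
    | mem g hg =>
      rcases hg with rfl | rfl
      · exact orb_rel_left _ _ _
      · exact orb_rel_right _ _ _
    | one => exact Setoid.refl' _ _
    | mul g h _ _ ihg ihh => exact Setoid.trans' _ ihh ihg
    | inv g _ ih =>
      have := ih (x := g⁻¹ x)
      rw [← Perm.mul_apply, mul_inv_cancel, Perm.one_apply] at this
      exact Setoid.symm' _ this

theorem connected_iff {D : ℕ} [NeZero D] {σ α : Perm (Fin D)} :
    (∀ d e : Fin D, ∃ g ∈ Subgroup.closure ({σ, α} : Set (Perm (Fin D))), g d = e) ↔
      classCount (orb σ α) = 1 := by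
  simp only [classCount_eq_one_iff, orb_iff_exists_mem_closure]

theorem rootedMap_ext {D : ℕ} {M M' : RootedMap D} (h₁ : M.σ = M'.σ) (h₂ : M.α = M'.α)
    (h₃ : M.root = M'.root) : M = M' := by
  cases M; cases M'; congr

instance {D : ℕ} : Finite (RootedMap D) :=
  Finite.of_injective (fun M => (M.σ, M.α, M.root)) fun M M' h => by
    simp only [Prod.mk.injEq] at h
    exact rootedMap_ext h.1 h.2.1 h.2.2

theorem card_planarMap {n : ℕ} (hn : 1 ≤ n) :
    Nat.card {M : RootedMap (2 * n) // IsPlanarMap M} =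
      ∑ d ∈ Finset.range (2 * n + 2), stubCount (2 * n) d := by
  have : NeZero (2 * n) := ⟨by omega⟩
  have hcard : Nat.card (Option (Fin (2 * n))) = 2 * n + 1 := by simp
  trans Nat.card {p : Perm (Option (Fin (2 * n))) × Perm (Option (Fin (2 * n))) //
    IsStubMap none p.1 p.2}
  · symm
    refine card_subtype_of_injective (fun M => (ins M.σ M.root, optionCongr M.α)) ?_ ?_
    · rintro M M' - - h
      obtain ⟨h1, h2⟩ := Prod.mk.inj h
      have h3 : ins M'.σ M'.root (some M.root) = none := by rw [← h1, ins_some_self]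
      have h4 : M.root = M'.root := by
        by_contra hne
        rw [ins_some_of_ne _ hne] at h3
        cases h3
      rw [h4] at h1
      exact rootedMap_ext (ins_injective _ h1) (optionCongr_injective h2) h4
    · rintro ⟨σ, α⟩
      constructor
      · intro h
        dsimp only at h
        obtain ⟨α, rfl⟩ : ∃ α', α = optionCongr α' :=
          ⟨_, (optionCongr_removeNone_of_none ((h.fixed none).2 rfl)).symm⟩
        obtain ⟨w, hw⟩ := σ.surjective none
        rcases w with _ | w
        · exact absurd hw h.apply_ne
        obtain ⟨σ, rfl⟩ := exists_eq_ins hw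
        obtain ⟨y, rfl⟩ := α.surjective w
        obtain ⟨a, b, c, d⟩ := h
        have a' : ∀ x, α (α x) = x := fun x => by simpa using a (some x)
        have b' : ∀ x, α x ≠ x := fun x => by simpa using b (some x)
        rw [orb_ins_optionCongr, classCount_insSetoid] at c
        rw [ins_mul_optionCongr, cycleCount_ins, cycleCount_ins, cycleCount_optionCongr,
          hcard] at d
        have h2 := cycleCount_involution a' b'
        rw [Nat.card_eq_fintype_card, Fintype.card_fin] at h2
        refine ⟨⟨σ, α, α y, a', b', connected_iff.2 c⟩, ?_, rfl⟩
        rw [IsPlanarMap, orbitCount_eq_cycleCount, orbitCount_eq_cycleCount]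
        dsimp only
        omega
      · rintro ⟨M, hM, h⟩
        obtain ⟨rfl, rfl⟩ := Prod.mk.inj h
        dsimp only
        have h2 := cycleCount_involution M.α_invol M.α_fpf
        rw [Nat.card_eq_fintype_card, Fintype.card_fin] at h2
        rw [IsPlanarMap, orbitCount_eq_cycleCount, orbitCount_eq_cycleCount] at hM
        refine ⟨?_, ?_, ?_, ?_⟩
        · rw [Option.forall]; simp [M.α_invol]
        · rw [Option.forall]; simp [M.α_fpf]
        · rw [orb_ins_optionCongr, classCount_insSetoid, connected_iff.1 M.connected]
        · rw [cycleCount_ins, cycleCount_optionCongr, hcard]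
          conv_lhs => rw [← M.α_invol M.root]
          rw [ins_mul_optionCongr, cycleCount_ins]
          omega
  · rw [card_eq_sum_fiber _ (fun p : Perm (Option (Fin (2 * n))) × Perm (Option (Fin (2 * n))) =>
      Function.minimalPeriod (p.1 * p.2 : Perm _) none) (Finset.range (2 * n + 2))]
    · exact Finset.sum_congr rfl fun d _ => stubs_eq_stubCount hcard none d
    · intro p _
      have := minimalPeriod_le_card (p.1 * p.2) (none : Option (Fin (2 * n)))
      rw [Finset.mem_range]
      omega

/-- The action of relabellings on rooted maps. -/
def relabel {D : ℕ} [NeZero D] (e : Perm (Fin D)) (M : RootedMap D) : RootedMap D where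
  σ := e.permCongr M.σ
  α := e.permCongr M.α
  root := e M.root
  α_invol d := by simp [M.α_invol]
  α_fpf d h := M.α_fpf (e.symm d) (by simpa [Equiv.permCongr_apply, ← Equiv.eq_symm_apply] using h)
  connected := by
    rw [connected_iff, orb_permCongr, classCount_comap_symm]
    exact connected_iff.1 M.connected

theorem isPlanarMap_relabel {n : ℕ} [NeZero (2 * n)] {e : Perm (Fin (2 * n))}
    {M : RootedMap (2 * n)} : IsPlanarMap (relabel e M) ↔ IsPlanarMap M := by
  simp only [IsPlanarMap, orbitCount_eq_cycleCount, relabel, permCongr_mul', cycleCount_permCongr]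

theorem mapIso_iff {D : ℕ} [NeZero D] {M M' : RootedMap D} :
    MapIso M M' ↔ ∃ e, relabel e M = M' := by
  refine exists_congr fun e => ?_
  constructor
  · rintro ⟨h1, h2, h3⟩
    refine rootedMap_ext ?_ ?_ h3
    · ext x : 1
      simp [relabel, h1]
    · ext x : 1
      simp [relabel, h2]
  · rintro rfl
    simp [relabel]

theorem relabel_injective {D : ℕ} [NeZero D] (M : RootedMap D) :
    Function.Injective fun e => relabel e M := by
  intro e e' h
  have hσ : ∀ x, e.permCongr M.σ x = e'.permCongr M.σ x := fun x =>
    congrArg (fun N : RootedMap D => N.σ x) h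
  have hα : ∀ x, e.permCongr M.α x = e'.permCongr M.α x := fun x =>
    congrArg (fun N : RootedMap D => N.α x) h
  have hroot : e M.root = e' M.root := congrArg RootedMap.root h
  have step : ∀ π : Perm (Fin D), (∀ x, e.permCongr π x = e'.permCongr π x) →
      ∀ x, e x = e' x ↔ e (π x) = e' (π x) := by
    intro π hπ x
    have h1 := hπ (e x)
    rw [Equiv.permCongr_apply, Equiv.symm_apply_apply] at h1
    constructor
    · intro hx
      rw [h1, hx, Equiv.permCongr_apply, Equiv.symm_apply_apply]
    · intro hx
      rw [h1, Equiv.permCongr_apply, e'.apply_eq_iff_eq, π.apply_eq_iff_eq,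
        Equiv.symm_apply_eq] at hx
      exact hx
  have hle : orb M.σ M.α ≤ Setoid.ker fun x => e x = e' x :=
    orb_le_iff.2 ⟨fun x => propext (step _ hσ x), fun x => propext (step _ hα x)⟩
  ext x : 1
  have := hle (classCount_eq_one_iff.1 (connected_iff.1 M.connected) M.root x)
  rw [Setoid.ker_def] at this
  exact this.mp hroot

theorem relabel_mul {D : ℕ} [NeZero D] (e e' : Perm (Fin D)) (M : RootedMap D) :
    relabel e (relabel e' M) = relabel (e * e') M :=
  rootedMap_ext rfl rfl rfl

theorem relabel_one {D : ℕ} [NeZero D] (M : RootedMap D) : relabel 1 M = M :=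
  rootedMap_ext rfl rfl rfl

theorem mapIso_equivalence {n : ℕ} [NeZero (2 * n)] :
    Equivalence fun M M' : {M : RootedMap (2 * n) // IsPlanarMap M} => MapIso M.1 M'.1 where
  refl M := mapIso_iff.2 ⟨1, relabel_one _⟩
  symm {M M'} h := by
    obtain ⟨e, he⟩ := mapIso_iff.1 h
    exact mapIso_iff.2 ⟨e⁻¹, by rw [← he, relabel_mul, inv_mul_cancel, relabel_one]⟩
  trans {M M' M''} h h' := by
    obtain ⟨e, he⟩ := mapIso_iff.1 h
    obtain ⟨e', he'⟩ := mapIso_iff.1 h'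
    exact mapIso_iff.2 ⟨e' * e, by rw [← he', ← he, relabel_mul]⟩

/-- Rooted maps have no nontrivial automorphisms. -/
theorem card_quot_mapIso {n : ℕ} (hn : 1 ≤ n) :
    Nat.card (Quot fun M M' : {M : RootedMap (2 * n) // IsPlanarMap M} => MapIso M.1 M'.1) *
      (2 * n).factorial = ∑ d ∈ Finset.range (2 * n + 2), stubCount (2 * n) d := by
  have : NeZero (2 * n) := ⟨by omega⟩
  rw [← card_planarMap hn, show (2 * n).factorial = Nat.card (Perm (Fin (2 * n))) by
    rw [Nat.card_perm, Nat.card_eq_fintype_card, Fintype.card_fin], ← Nat.card_prod]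
  have hexact : ∀ M M' : {M : RootedMap (2 * n) // IsPlanarMap M},
      Quot.mk (fun M M' : {M : RootedMap (2 * n) // IsPlanarMap M} => MapIso M.1 M'.1) M =
        Quot.mk _ M' ↔ MapIso M.1 M'.1 := fun M M' => by
    rw [Quot.eq, mapIso_equivalence.eqvGen_iff]
  refine Nat.card_congr (Equiv.ofBijective
    (fun p => ⟨relabel p.2 p.1.out.1, isPlanarMap_relabel.2 p.1.out.2⟩) ⟨?_, ?_⟩)
  · rintro ⟨q, e⟩ ⟨q', e'⟩ h
    have h1 : relabel e q.out.1 = relabel e' q'.out.1 := congrArg Subtype.val h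
    have h2 : q = q' := by
      rw [← Quot.out_eq q, ← Quot.out_eq q', hexact]
      exact mapIso_iff.2 ⟨e'⁻¹ * e, by
        rw [← relabel_mul, h1, relabel_mul, inv_mul_cancel, relabel_one]⟩
    subst h2
    exact Prod.ext rfl (relabel_injective _ h1)
  · intro M
    obtain ⟨e, he⟩ := mapIso_iff.1 ((hexact _ M).1 (Quot.out_eq (Quot.mk _ M)))
    exact ⟨(Quot.mk _ M, e), Subtype.ext he⟩

end Rooted

section GeneratingFunction

open Polynomial

/-! ### Tutte's functional equation -/

/-- The generating polynomial of maps on `m` darts and one stub by root face degree. -/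
noncomputable def facePoly (m : ℕ) : ℚ[X] :=
  ∑ d ∈ Finset.range (m + 2), C ((stubCount m d : ℚ) / m.factorial) * X ^ d

theorem coeff_facePoly (m d : ℕ) :
    (facePoly m).coeff d = (stubCount m d : ℚ) / m.factorial := by
  rw [facePoly, finsetSum_coeff]
  simp only [coeff_C_mul_X_pow]
  rw [Finset.sum_ite_eq]
  split_ifs with h
  · rfl
  · rw [stubCount_eq_zero (by simpa using h), Nat.cast_zero, zero_div]

theorem facePoly_zero : facePoly 0 = X := by
  ext d
  rw [coeff_facePoly, stubCount_zero_left, coeff_X]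
  simp [eq_comm]

theorem facePoly_one : facePoly 1 = 0 := by
  ext d
  rw [coeff_facePoly, stubCount_one_left, coeff_zero, Nat.cast_zero, zero_div]

theorem eval_one_facePoly (m : ℕ) :
    (facePoly m).eval 1 = ((∑ d ∈ Finset.range (m + 2), stubCount m d : ℕ) : ℚ) / m.factorial := by
  simp [facePoly, eval_finsetSum, Finset.sum_div]

theorem facePoly_add_two (m : ℕ) :
    facePoly (m + 2) =
      X * ∑ j ∈ Finset.HasAntidiagonal.antidiagonal m, facePoly j.1 * facePoly j.2 +
      ∑ d ∈ Finset.range (m + 2), C ((stubCount m d : ℚ) / m.factorial) *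
        (X ^ 2 * ∑ i ∈ Finset.range d, X ^ i) := by
  ext k
  rcases k with _ | d
  · simp [coeff_facePoly, stubCount_zero_right, mul_coeff_zero]
  have hm : ((m + 2).factorial : ℚ) = (m + 2) * (m + 1) * m.factorial := by
    rw [Nat.factorial_succ, Nat.factorial_succ]; push_cast; ring
  have hm0 : (m.factorial : ℚ) ≠ 0 := by positivity
  rw [coeff_facePoly, stubCount_add_two, coeff_add, coeff_X_mul, finsetSum_coeff,
    finsetSum_coeff, hm]
  push_cast
  rw [mul_div_mul_left _ _ (by positivity), add_div, Finset.sum_div, Finset.sum_div]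
  congr 1
  · refine Finset.sum_congr rfl fun j hj => ?_
    rw [coeff_mul, Finset.mul_sum, Finset.sum_div]
    refine Finset.sum_congr rfl fun e _ => ?_
    rw [Finset.HasAntidiagonal.mem_antidiagonal] at hj
    have h := Nat.choose_mul_factorial_mul_factorial (show j.1 ≤ m by omega)
    rw [show m - j.1 = j.2 by omega] at h
    have h' : (m.factorial : ℚ) = m.choose j.1 * j.1.factorial * j.2.factorial := by
      rw [← h]; push_cast; ring
    have hc : (m.choose j.1 : ℚ) ≠ 0 := by
      have := Nat.choose_pos (show j.1 ≤ m by omega)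
      positivity
    rw [coeff_facePoly, coeff_facePoly, h']
    have h1 : (j.1.factorial : ℚ) ≠ 0 := by positivity
    have h2 : (j.2.factorial : ℚ) ≠ 0 := by positivity
    field_simp
  · refine Finset.sum_congr rfl fun d' _ => ?_
    rw [coeff_C_mul, pow_two, mul_assoc, coeff_X_mul]
    rcases d with _ | i
    · simp
    · rw [coeff_X_mul, finsetSum_coeff]
      simp only [coeff_X_pow, Finset.sum_ite_eq, Finset.mem_range]
      by_cases h : i < d'
      · rw [if_pos ⟨by omega, h⟩, if_pos h, mul_one]
      · rw [if_neg (fun h' => h h'.2), if_neg h, zero_div, mul_zero]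

theorem facePoly_functional (m : ℕ) :
    (X - 1) * (facePoly (m + 2) -
      X * ∑ j ∈ Finset.HasAntidiagonal.antidiagonal m, facePoly j.1 * facePoly j.2) =
    X ^ 2 * (facePoly m - C ((facePoly m).eval 1)) := by
  rw [facePoly_add_two, add_sub_cancel_left, Finset.mul_sum]
  have h : C ((facePoly m).eval 1) =
      ∑ d ∈ Finset.range (m + 2), C ((stubCount m d : ℚ) / m.factorial) := by
    rw [facePoly, eval_finsetSum, map_sum]
    simp
  rw [h]
  conv_rhs => rw [facePoly]
  rw [← Finset.sum_sub_distrib, Finset.mul_sum]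
  refine Finset.sum_congr rfl fun d _ => ?_
  have := geom_sum_mul (X : ℚ[X]) d
  linear_combination (C ((stubCount m d : ℚ) / m.factorial) * X ^ 2) * this

/-- The specialization at face weight `1`. -/
noncomputable def specOne : ℚ[X] →+* ℚ[X] := C.comp (evalRingHom 1)

/-- Tutte's equation with catalytic variable `X`. -/
def IsTutteSolution (G : PowerSeries ℚ[X]) : Prop :=
  PowerSeries.C (X - 1 : ℚ[X]) * (G - PowerSeries.C X -
      PowerSeries.X ^ 2 * PowerSeries.C X * G ^ 2) =
    PowerSeries.X ^ 2 * PowerSeries.C (X ^ 2) * (G - PowerSeries.map specOne G)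

/-- The generating function of rooted planar maps. -/
noncomputable def mapSeries : PowerSeries ℚ[X] := PowerSeries.mk facePoly

theorem isTutteSolution_mapSeries : IsTutteSolution mapSeries := by
  ext1 k
  rw [mul_assoc, mul_assoc, PowerSeries.coeff_C_mul, map_sub, map_sub]
  rcases k with _ | _ | m
  · simp [mapSeries, facePoly_zero]
  · rw [PowerSeries.coeff_X_pow_mul', PowerSeries.coeff_X_pow_mul']
    simp [mapSeries, facePoly_one]
  · rw [show m + 1 + 1 = m + 2 from rfl, PowerSeries.coeff_X_pow_mul, PowerSeries.coeff_X_pow_mul,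
      PowerSeries.coeff_C_mul,
      PowerSeries.coeff_C_mul, PowerSeries.coeff_C, if_neg (by omega), sub_zero, pow_two mapSeries,
      PowerSeries.coeff_mul, map_sub, PowerSeries.coeff_map]
    simp only [mapSeries, PowerSeries.coeff_mk]
    exact facePoly_functional m

theorem IsTutteSolution.unique {G H : PowerSeries ℚ[X]} (hG : IsTutteSolution G)
    (hH : IsTutteSolution H) : G = H := by
  have key : ∀ k, (PowerSeries.X : PowerSeries ℚ[X]) ^ k ∣ G - H := by
    intro k
    induction k with
    | zero => simp
    | succ k ih =>
      have hmap : (PowerSeries.X : PowerSeries ℚ[X]) ^ k ∣ PowerSeries.map specOne (G - H) := by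
        have := map_dvd (PowerSeries.map specOne) ih
        rwa [map_pow, PowerSeries.map_X] at this
      obtain ⟨D, hD⟩ := ih
      obtain ⟨E, hE⟩ := hmap
      rw [map_sub] at hE
      have h : (PowerSeries.X : PowerSeries ℚ[X]) ^ (k + 1) ∣
          PowerSeries.C (X - 1 : ℚ[X]) * (G - H) := by
        refine ⟨PowerSeries.X * (PowerSeries.C (X - 1) * PowerSeries.C X * D * (G + H) +
          PowerSeries.C (X ^ 2) * (D - E)), ?_⟩
        rw [IsTutteSolution] at hG hH
        linear_combination hG - hH + (PowerSeries.X ^ 2 * (PowerSeries.C (X - 1) *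
          PowerSeries.C X * (G + H)) + PowerSeries.X ^ 2 * PowerSeries.C (X ^ 2)) * hD -
          PowerSeries.X ^ 2 * PowerSeries.C (X ^ 2) * hE
      rw [PowerSeries.X_pow_dvd_iff] at h ⊢
      intro m hm
      have := h m hm
      rw [PowerSeries.coeff_C_mul] at this
      exact (mul_eq_zero.1 this).resolve_left (X_sub_C_ne_zero 1)
  rw [← sub_eq_zero]
  ext1 k
  exact PowerSeries.X_pow_dvd_iff.1 (key (k + 1)) k (by omega)

/-- Quadratic equations with small coefficients are solvable in power series. -/
theorem exists_powerSeries_eq {A : Type*} [CommRing A] (a b c : PowerSeries A) :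
    ∃ N : PowerSeries A, N = a + PowerSeries.X * (b * N + c * N ^ 2) := by
  let Φ : PowerSeries A → PowerSeries A := fun N => a + PowerSeries.X * (b * N + c * N ^ 2)
  have hΦ : ∀ k M N, PowerSeries.X ^ k ∣ M - N → PowerSeries.X ^ (k + 1) ∣ Φ M - Φ N := by
    rintro k M N ⟨D, hD⟩
    refine ⟨(b + c * (M + N)) * D, ?_⟩
    linear_combination PowerSeries.X * (b + c * (M + N)) * hD
  have hstep : ∀ k l, PowerSeries.X ^ k ∣ Φ^[k + l] 0 - Φ^[k] 0 := by
    intro k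
    induction k with
    | zero => intro l; simp
    | succ k ih =>
      intro l
      rw [show k + 1 + l = (k + l) + 1 by ring, Function.iterate_succ_apply',
        Function.iterate_succ_apply']
      exact hΦ _ _ _ (ih l)
  set N : PowerSeries A := PowerSeries.mk fun k => PowerSeries.coeff k (Φ^[k + 1] 0)
  have hN : ∀ k, PowerSeries.X ^ k ∣ N - Φ^[k] 0 := by
    intro k
    rw [PowerSeries.X_pow_dvd_iff]
    intro m hm
    obtain ⟨l, rfl⟩ := Nat.exists_eq_add_of_lt hm
    have := PowerSeries.X_pow_dvd_iff.1 (hstep (m + 1) l) m (by omega)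
    rw [map_sub, sub_eq_zero] at this ⊢
    rw [PowerSeries.coeff_mk, ← this]
    ring_nf
  refine ⟨N, ?_⟩
  change N = Φ N
  rw [← sub_eq_zero]
  ext1 k
  have h1 := hN (k + 1)
  have h2 := hΦ _ _ _ (hN k)
  rw [← Function.iterate_succ_apply' Φ] at h2
  have h3 := dvd_sub h1 h2
  rw [sub_sub_sub_cancel_right] at h3
  exact PowerSeries.X_pow_dvd_iff.1 h3 k (by omega)

/-- The series `R = 1 + 3 * z * R ^ 2` in the variable `z = w ^ 2`. -/
noncomputable def treeSeries : PowerSeries ℚ :=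
  PowerSeries.expand 2 two_ne_zero
    (PowerSeries.rescale 3 (PowerSeries.map (Nat.castRingHom ℚ) PowerSeries.catalanSeries))

theorem treeSeries_eq : treeSeries = 1 + 3 * PowerSeries.X ^ 2 * treeSeries ^ 2 := by
  have h := congrArg (fun f => PowerSeries.expand 2 two_ne_zero (PowerSeries.rescale (3 : ℚ)
    (PowerSeries.map (Nat.castRingHom ℚ) f))) PowerSeries.catalanSeries_sq_mul_X_add_one
  simp only [map_add, map_mul, map_pow, map_one, PowerSeries.map_X, PowerSeries.rescale_X,
    PowerSeries.expand_X, PowerSeries.expand_C] at h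
  rw [← treeSeries, map_ofNat] at h
  linear_combination -h

theorem coeff_treeSeries (n : ℕ) :
    PowerSeries.coeff (2 * n) treeSeries = 3 ^ n * (catalan n : ℚ) := by
  simp [treeSeries, PowerSeries.coeff_expand_mul, PowerSeries.coeff_rescale]

theorem tutte_identity {A : Type*} [CommRing A] {w x R N : A} (hR : R = 1 + 3 * w ^ 2 * R ^ 2)
    (hN : N = R + w * (3 * w * R * x * N + w * x * (x - 1) * N ^ 2)) {G : A}
    (hG : G = R + (x - 1 - x * (w ^ 2 * R)) * N) :
    (x - 1) * (G - x - w ^ 2 * x * G ^ 2) = w ^ 2 * x ^ 2 * (G - (R - w ^ 2 * R ^ 3)) := by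
  subst hG
  linear_combination (x - 1 - x * (w ^ 2 * R)) ^ 2 * hN +
    (w ^ 2 * (x - 1 - x * (w ^ 2 * R)) * x ^ 2 * N + x * (x - 1)) * hR

/-- The generating function of rooted planar maps, parametrized by trees. -/
theorem map_specOne_mapSeries :
    PowerSeries.map specOne mapSeries =
      PowerSeries.map C (treeSeries - PowerSeries.X ^ 2 * treeSeries ^ 3) := by
  obtain ⟨R, hR⟩ : ∃ R, R = PowerSeries.map (C : ℚ →+* ℚ[X]) treeSeries := ⟨_, rfl⟩
  have hRe : R = 1 + 3 * PowerSeries.X ^ 2 * R ^ 2 := by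
    have := congrArg (PowerSeries.map (C : ℚ →+* ℚ[X])) treeSeries_eq
    rwa [map_add, map_mul, map_mul, map_pow, map_pow, PowerSeries.map_X, map_one, map_ofNat,
      ← hR] at this
  obtain ⟨x, hx⟩ : ∃ x : PowerSeries ℚ[X], x = PowerSeries.C X := ⟨_, rfl⟩
  obtain ⟨N, hN⟩ := exists_powerSeries_eq R (3 * PowerSeries.X * R * x)
    (PowerSeries.X * x * (x - 1))
  have hspecR : PowerSeries.map specOne R = R := by
    rw [hR]
    ext1 k
    simp [specOne]
  have hspecx : PowerSeries.map specOne x = 1 := by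
    rw [hx, PowerSeries.map_C]
    simp [specOne]
  have hspecN : PowerSeries.map specOne N = R ^ 2 := by
    have := congrArg (PowerSeries.map specOne) hN
    simp only [map_add, map_mul, map_pow, map_sub, hspecR, hspecx, PowerSeries.map_X,
      map_ofNat, map_one] at this
    generalize PowerSeries.map specOne N = N₁ at this ⊢
    linear_combination R * this - N₁ * hRe
  obtain ⟨G, hG⟩ : ∃ G, G = R + (x - 1 - x * (PowerSeries.X ^ 2 * R)) * N := ⟨_, rfl⟩
  have hspecG : PowerSeries.map specOne G = R - PowerSeries.X ^ 2 * R ^ 3 := by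
    rw [hG]
    simp only [map_add, map_mul, map_pow, map_sub, hspecR, hspecx, hspecN, PowerSeries.map_X,
      map_one]
    ring
  have hsol : IsTutteSolution G := by
    rw [IsTutteSolution, hspecG, map_sub, map_pow, map_one, ← hx]
    exact tutte_identity hRe hN hG
  rw [isTutteSolution_mapSeries.unique hsol, hspecG, map_sub, map_mul, map_pow, map_pow,
    PowerSeries.map_X, ← hR]

theorem three_mul_catalan (n : ℕ) :
    (4 * 3 ^ n * catalan n - 3 ^ n * catalan (n + 1) : ℚ) =
      3 * (2 * 3 ^ n * (2 * n).factorial / ((n + 2).factorial * n.factorial)) := by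
  have h1 : ((2 * n).factorial : ℚ) = (n + 1) * catalan n * n.factorial * n.factorial := by
    have h := Nat.centralBinom_eq_two_mul_choose n
    rw [← succ_mul_catalan_eq_centralBinom] at h
    have h' := Nat.choose_mul_factorial_mul_factorial (show n ≤ 2 * n by omega)
    rw [← h, show 2 * n - n = n by omega] at h'
    exact_mod_cast h'.symm
  have h2 : ((n + 2) * catalan (n + 1) : ℚ) = 2 * (2 * n + 1) * catalan n := by
    have h := Nat.succ_mul_centralBinom_succ n
    rw [← succ_mul_catalan_eq_centralBinom, ← succ_mul_catalan_eq_centralBinom] at h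
    have h' : ((n + 1) * ((n + 1 + 1) * catalan (n + 1)) : ℚ) =
        2 * (2 * n + 1) * ((n + 1) * catalan n) := by exact_mod_cast h
    have h0 : (n + 1 : ℚ) ≠ 0 := by positivity
    apply mul_left_cancel₀ h0
    linear_combination h'
  have h3 : ((n + 2).factorial : ℚ) = (n + 2) * (n + 1) * n.factorial := by
    rw [Nat.factorial_succ, Nat.factorial_succ]; push_cast; ring
  have h4 : (n.factorial : ℚ) ≠ 0 := by positivity
  have h5 : (n + 1 : ℚ) ≠ 0 := by positivity
  have h6 : (n + 2 : ℚ) ≠ 0 := by positivity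
  have h7 : (catalan (n + 1) : ℚ) = 2 * (2 * n + 1) * catalan n / (n + 2) := by
    rw [eq_div_iff h6]; linear_combination h2
  rw [h1, h3, h7]
  field_simp
  ring

theorem eval_one_facePoly_two_mul (n : ℕ) :
    (facePoly (2 * n)).eval 1 =
      2 * 3 ^ n * (2 * n).factorial / ((n + 2).factorial * n.factorial) := by
  have h := congrArg (PowerSeries.coeff (2 * n)) map_specOne_mapSeries
  rw [PowerSeries.coeff_map, PowerSeries.coeff_map, mapSeries, PowerSeries.coeff_mk] at h
  have h' : (facePoly (2 * n)).eval 1 =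
      PowerSeries.coeff (2 * n) (treeSeries - PowerSeries.X ^ 2 * treeSeries ^ 3) :=
    C_injective h
  have h3 : PowerSeries.C (9 : ℚ) *
        (PowerSeries.X ^ 2 * (treeSeries - PowerSeries.X ^ 2 * treeSeries ^ 3)) =
      PowerSeries.C (12 : ℚ) * (PowerSeries.X ^ 2 * treeSeries) - (treeSeries - 1) := by
    rw [map_ofNat, map_ofNat]
    linear_combination (1 + 3 * PowerSeries.X ^ 2 * treeSeries) * treeSeries_eq
  have h4 := congrArg (PowerSeries.coeff (2 * n + 2)) h3
  rw [map_sub, map_sub, PowerSeries.coeff_C_mul, PowerSeries.coeff_C_mul,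
    PowerSeries.coeff_X_pow_mul, PowerSeries.coeff_X_pow_mul, ← h', coeff_treeSeries,
    show 2 * n + 2 = 2 * (n + 1) by ring, coeff_treeSeries, PowerSeries.coeff_one,
    if_neg (by omega)] at h4
  have h5 := three_mul_catalan n
  rw [pow_succ] at h4
  linarith

end GeneratingFunction

end MapCount

/-- The number of rooted planar maps with `n` edges equals
`2 · 3^n · (2n)! / ((n+2)! · n!)`. -/
theorem stmt_5 (n : ℕ) (hn : 1 ≤ n) :
    (Nat.card (Quot (fun M M' : {M : RootedMap (2 * n) // IsPlanarMap M} =>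
        MapIso M.1 M'.1)) : ℚ)
      = 2 * 3 ^ n * Nat.factorial (2 * n) /
          (Nat.factorial (n + 2) * Nat.factorial n) := by
  have h := MapCount.card_quot_mapIso hn
  have h0 : ((2 * n).factorial : ℚ) ≠ 0 := mod_cast (2 * n).factorial_ne_zero
  rw [← MapCount.eval_one_facePoly_two_mul, MapCount.eval_one_facePoly, eq_div_iff h0, ← h]
  push_cast
  rfl
end

section
/- The number of rooted one-face cubic maps of genus g (maps of genus g with one face and all vertices of degree 3, which necessarily have 4g-2 vertices and 6g-3 edges) is (2/12^g) * (6g-3)! / (g! * (3g-2)!). -/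
/-- A rooted one-face cubic map of genus `g`: a rooted map with `6g - 3` edges,
every vertex of degree `3` and exactly one face.  (By Euler\'s formula such a map
has `4g - 2` vertices and embeds in the surface of genus `g`.) -/
def IsOneFaceCubic {g : ℕ} (M : RootedMap (2 * (6 * g - 3))) : Prop :=
  (∀ d, (M.σ ^ 3) d = d ∧ M.σ d ≠ d) ∧ orbitCount (M.σ * M.α) = 1

open Equiv

section FullCycle

variable {A B : Type}

/-- A permutation all of whose points lie on a single cycle. -/
def IsFullCycle (γ : Perm A) : Prop := ∀ x y, γ.SameCycle x y

lemma Equiv.Perm.SameCycle.map_of_step {γ : Perm A} {δ : Perm B} (f : A → B)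
    (hf : ∀ z, δ.SameCycle (f z) (f (γ z))) {z w : A} (h : γ.SameCycle z w) :
    δ.SameCycle (f z) (f w) := by
  obtain ⟨n, rfl⟩ := h
  induction n with
  | zero => simp [Perm.SameCycle.refl]
  | succ n ih =>
    rw [add_comm, zpow_add, zpow_one, Perm.mul_apply]
    exact ih.trans (hf _)
  | pred n ih =>
    refine ih.trans ?_
    have := hf ((γ ^ (-(n : ℤ) - 1)) z)
    rw [← Perm.mul_apply, ← zpow_one_add] at this
    convert this.symm using 4
    ring

lemma IsFullCycle.of_surjective {γ : Perm A} {δ : Perm B} (h : IsFullCycle γ) (f : A → B)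
    (hf : Function.Surjective f) (hs : ∀ z, δ.SameCycle (f z) (f (γ z))) : IsFullCycle δ := by
  intro x y
  obtain ⟨x, rfl⟩ := hf x
  obtain ⟨y, rfl⟩ := hf y
  exact (h x y).map_of_step f hs

lemma IsFullCycle.mem_of_mapsTo [Finite A] {γ : Perm A} (h : IsFullCycle γ) {S : Set A}
    (hS : ∀ x ∈ S, γ x ∈ S) {a : A} (ha : a ∈ S) (b : A) : b ∈ S := by
  obtain ⟨n, -, rfl⟩ := (h a b).exists_pow_eq'
  clear h
  induction n with
  | zero => simpa
  | succ n ih => rw [pow_succ', Perm.mul_apply]; exact hS _ ih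

/-- `p` numbers the points along the cycle `γ` by `0, 1, …, |A| - 1`. -/
structure IsPosition (γ : Perm A) (p : A → ℕ) : Prop where
  inj : Function.Injective p
  lt : ∀ d, p d < Nat.card A
  step : ∀ d, p (γ d) = if p d + 1 = Nat.card A then 0 else p d + 1

lemma IsFullCycle.exists_isPosition [Finite A] {γ : Perm A} (h : IsFullCycle γ) :
    ∃ p, IsPosition γ p := by
  classical
  have := Fintype.ofFinite A
  rcases isEmpty_or_nonempty A with _ | ⟨⟨z⟩⟩
  · exact ⟨fun _ => 0, fun x => isEmptyElim x, fun x => isEmptyElim x, fun x => isEmptyElim x⟩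
  have hc : γ.IsCycleOn (Finset.univ : Finset A) :=
    ⟨by simp, fun x _ y _ => h x y⟩
  choose p hp hpz using fun d => hc.exists_pow_eq (Finset.mem_univ z) (Finset.mem_univ d)
  have hcard : (Finset.univ : Finset A).card = Nat.card A := by simp
  rw [hcard] at hp
  refine ⟨p, fun x y hxy => by rw [← hpz x, ← hpz y, hxy], hp, fun d => ?_⟩
  have h1 : (γ ^ (p (γ d))) z = (γ ^ (p d + 1)) z := by
    rw [hpz, pow_succ', Perm.mul_apply, hpz]
  rw [hc.pow_apply_eq_pow_apply (Finset.mem_univ z), hcard] at h1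
  have h2 := hp (γ d)
  have h3 := hp d
  unfold Nat.ModEq at h1
  rw [Nat.mod_eq_of_lt h2] at h1
  split_ifs with h4
  · rw [h1, h4, Nat.mod_self]
  · rw [h1, Nat.mod_eq_of_lt (by omega)]

lemma IsPosition.rebase {γ : Perm A} {p : A → ℕ} (hp : IsPosition γ p) (a : A) :
    IsPosition γ fun e => if p a ≤ p e then p e - p a else p e + Nat.card A - p a := by
  have ha := hp.lt a
  refine ⟨fun x y h => hp.inj ?_, fun d => ?_, fun d => ?_⟩
  · have := hp.lt x
    have := hp.lt y
    beta_reduce at h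
    split_ifs at h <;> omega
  · have := hp.lt d
    split_ifs <;> omega
  · have := hp.lt d
    rw [hp.step]
    split_ifs <;> omega

variable [DecidableEq A]

/-- The permutation `a ↦ b ↦ c ↦ a`. -/
def triCycle (a b c : A) : Perm A := swap a b * swap b c

section
variable {a b c : A}

lemma triCycle_fst (hab : a ≠ b) (hac : a ≠ c) : triCycle a b c a = b := by
  simp [triCycle, swap_apply_of_ne_of_ne hab hac]

lemma triCycle_snd (hac : a ≠ c) (hbc : b ≠ c) : triCycle a b c b = c := by
  simp [triCycle, swap_apply_of_ne_of_ne hac.symm hbc.symm]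

lemma triCycle_trd : triCycle a b c c = a := by
  simp [triCycle]

lemma triCycle_of_ne {d : A} (ha : d ≠ a) (hb : d ≠ b) (hc : d ≠ c) :
    triCycle a b c d = d := by
  simp [triCycle, swap_apply_of_ne_of_ne, *]

lemma triCycle_rotate (hab : a ≠ b) (hac : a ≠ c) (hbc : b ≠ c) :
    triCycle a b c = triCycle b c a := by
  ext d
  by_cases ha : d = a
  · subst ha; rw [triCycle_fst hab hac, triCycle_trd]
  by_cases hb : d = b
  · subst hb; rw [triCycle_snd hac hbc, triCycle_fst hbc hab.symm]
  by_cases hc : d = c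
  · subst hc; rw [triCycle_trd, triCycle_snd hab.symm hac.symm]
  rw [triCycle_of_ne ha hb hc, triCycle_of_ne hb hc ha]

lemma triCycle_inv (hab : a ≠ b) (hac : a ≠ c) (hbc : b ≠ c) :
    (triCycle a b c)⁻¹ = triCycle a c b := by
  rw [inv_eq_iff_mul_eq_one]
  ext d
  rw [Perm.mul_apply, Perm.one_apply]
  by_cases ha : d = a
  · subst ha; rw [triCycle_fst hac hab, triCycle_trd]
  by_cases hb : d = b
  · subst hb; rw [triCycle_trd, triCycle_fst hab hac]
  by_cases hc : d = c
  · subst hc; rw [triCycle_snd hab hbc.symm, triCycle_snd hac hbc]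
  rw [triCycle_of_ne ha hc hb, triCycle_of_ne ha hb hc]

variable [Finite A] {γ : Perm A} {p : A → ℕ}

omit [DecidableEq A] [Finite A] in
lemma IsPosition.sameCycle_of_le (hp : IsPosition γ p) {δ : Perm A} {x : A} :
    ∀ e, p x ≤ p e → (∀ d, p x < p d → p d ≤ p e → δ (γ⁻¹ d) = d) → δ.SameCycle x e := by
  suffices ∀ n, ∀ e, p e = n → p x ≤ p e →
      (∀ d, p x < p d → p d ≤ p e → δ (γ⁻¹ d) = d) → δ.SameCycle x e from
    fun e => this _ e rfl
  intro n
  induction n with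
  | zero =>
    intro e he hxe _
    rw [hp.inj (a₁ := x) (a₂ := e) (by omega)]
  | succ n ih =>
    intro e he hxe hd
    rcases hxe.eq_or_lt with h | h
    · rw [hp.inj h]
    have hs := hp.step (γ⁻¹ e)
    rw [show γ (γ⁻¹ e) = e by simp] at hs
    split_ifs at hs
    · omega
    · have := ih (γ⁻¹ e) (by omega) (by omega) fun d h1 h2 => hd d h1 (by omega)
      refine this.trans ⟨1, ?_⟩
      rw [zpow_one]
      exact hd e h le_rfl

omit [Finite A] in
lemma IsPosition.isFullCycle_triCycle_mul (hp : IsPosition γ p) (hab : p a < p b)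
    (hbc : p b < p c) : IsFullCycle (triCycle a b c * γ) := by
  wlog ha : p a = 0 generalizing p
  · refine this (hp.rebase a) ?_ ?_ ?_ <;> (try split_ifs) <;> omega
  have nab : a ≠ b := by rintro rfl; omega
  have nac : a ≠ c := by rintro rfl; omega
  have nbc : b ≠ c := by rintro rfl; omega
  set δ := triCycle a b c * γ with hδ
  have hδ' : ∀ d, δ (γ⁻¹ d) = triCycle a b c d := by intro d; simp [hδ]
  have walk : ∀ x e, p x ≤ p e → (∀ d, p x < p d → p d ≤ p e → d ≠ a ∧ d ≠ b ∧ d ≠ c) →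
      δ.SameCycle x e := by
    intro x e hxe h
    refine hp.sameCycle_of_le e hxe fun d h1 h2 => ?_
    obtain ⟨h3, h4, h5⟩ := h d h1 h2
    rw [hδ', triCycle_of_ne h3 h4 h5]
  have pred : ∀ d, 0 < p d → p (γ⁻¹ d) + 1 = p d := by
    intro d hd
    have hs := hp.step (γ⁻¹ d)
    rw [show γ (γ⁻¹ d) = d by simp] at hs
    split_ifs at hs <;> omega
  have key : ∀ d, p d ≠ p a → p d ≠ p b → p d ≠ p c → d ≠ a ∧ d ≠ b ∧ d ≠ c := by
    intro d h1 h2 h3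
    exact ⟨by rintro rfl; exact h1 rfl, by rintro rfl; exact h2 rfl, by rintro rfl; exact h3 rfl⟩
  have hac : δ.SameCycle a c := by
    have := pred b (by omega)
    refine (walk a (γ⁻¹ b) (by omega) fun d h1 h2 => key d ?_ ?_ ?_).trans ⟨1, ?_⟩
    · omega
    · omega
    · omega
    · rw [zpow_one, hδ', triCycle_snd nac nbc]
  have hba : δ.SameCycle b a := by
    have := pred c (by omega)
    refine (walk b (γ⁻¹ c) (by omega) fun d h1 h2 => key d ?_ ?_ ?_).trans ⟨1, ?_⟩
    · omega
    · omega
    · omega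
    · rw [zpow_one, hδ', triCycle_trd]
  have all : ∀ e, δ.SameCycle a e := by
    intro e
    by_cases h1 : p e < p b
    · exact walk a e (by omega) fun d _ _ => key d (by omega) (by omega) (by omega)
    by_cases h2 : p e < p c
    · exact hba.symm.trans
        (walk b e (by omega) fun d _ _ => key d (by omega) (by omega) (by omega))
    · exact hac.trans
        (walk c e (by omega) fun d _ _ => key d (by omega) (by omega) (by omega))
  exact fun x y => (all x).symm.trans (all y)

lemma IsPosition.not_isFullCycle_triCycle_inv_mul (hp : IsPosition γ p) (hab : p a < p b)
    (hbc : p b < p c) : ¬ IsFullCycle ((triCycle a b c)⁻¹ * γ) := by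
  wlog ha : p a = 0 generalizing p
  · refine this (hp.rebase a) ?_ ?_ ?_ <;> (try split_ifs) <;> omega
  have nab : a ≠ b := by rintro rfl; omega
  have nac : a ≠ c := by rintro rfl; omega
  have nbc : b ≠ c := by rintro rfl; omega
  rw [triCycle_inv nab nac nbc]
  intro h
  have := h.mem_of_mapsTo (S := {e | p e < p b}) ?_ (show p a < p b from hab) b
  · exact lt_irrefl (p b) this
  intro x (hx : p x < p b)
  have hs := hp.step x
  have := hp.lt b
  rw [if_neg (by omega)] at hs
  change p ((triCycle a c b) (γ x)) < p b
  by_cases hxb : p x + 1 = p b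
  · have : γ x = b := hp.inj (by omega)
    rwa [this, triCycle_trd]
  · have : triCycle a c b (γ x) = γ x := by
      apply triCycle_of_ne <;> intro h' <;> rw [h'] at hs <;> omega
    rw [this]
    omega

/-- Left multiplication by `triCycle a b c` keeps a full cycle connected exactly when `a`, `b`, `c`
occur in this cyclic order. -/
lemma IsPosition.isFullCycle_triCycle_mul_iff (hp : IsPosition γ p) (hab : a ≠ b) (hac : a ≠ c)
    (hbc : b ≠ c) : IsFullCycle (triCycle a b c * γ) ↔
      (p a < p b ∧ p b < p c ∨ p b < p c ∧ p c < p a ∨ p c < p a ∧ p a < p b) := by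
  have h1 := hp.inj.ne hab
  have h2 := hp.inj.ne hac
  have h3 := hp.inj.ne hbc
  have r1 := triCycle_rotate hab hac hbc
  have r2 := triCycle_rotate hbc hab.symm hac.symm
  have i1 := triCycle_inv hac hab hbc.symm
  have s1 := triCycle_rotate hac hab hbc.symm
  have s2 := triCycle_rotate hbc.symm hac.symm hab.symm
  constructor
  · intro h
    by_contra hn
    have : p a < p c ∧ p c < p b ∨ p c < p b ∧ p b < p a ∨ p b < p a ∧ p a < p c := by omega
    rcases this with ⟨u, v⟩ | ⟨u, v⟩ | ⟨u, v⟩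
    · exact hp.not_isFullCycle_triCycle_inv_mul u v (by rwa [i1])
    · exact hp.not_isFullCycle_triCycle_inv_mul u v (by rwa [← s1, i1])
    · exact hp.not_isFullCycle_triCycle_inv_mul u v (by rwa [← s2, ← s1, i1])
  · rintro (⟨u, v⟩ | ⟨u, v⟩ | ⟨u, v⟩)
    · exact hp.isFullCycle_triCycle_mul u v
    · rw [r1]; exact hp.isFullCycle_triCycle_mul u v
    · rw [r1, r2]; exact hp.isFullCycle_triCycle_mul u v

end
end FullCycle

section Precubic

variable {A B : Type}

/-- The pair `(σ, α)` is a one-face map with `k` vertices of degree one and all other vertices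
of degree three. -/
structure IsPrecubic (k : ℕ) (σ α : Perm A) : Prop where
  invol : ∀ d, α (α d) = d
  fpf : ∀ d, α d ≠ d
  cube : ∀ d, σ (σ (σ d)) = d
  full : IsFullCycle (σ * α)
  leaves : Nat.card {d // σ d = d} = k

/-- One-face maps on the dart set `A` with `k` leaves and all other vertices of degree three. -/
abbrev PrecubicMap (k : ℕ) (A : Type) : Type := {x : Perm A × Perm A // IsPrecubic k x.1 x.2}

lemma Nat.card_sigma_of_const {ι : Type*} [Finite ι] {F : ι → Type*} {m : ℕ} [∀ i, Finite (F i)]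
    (h : ∀ i, Nat.card (F i) = m) : Nat.card (Σ i, F i) = Nat.card ι * m := by
  have := Fintype.ofFinite ι
  simp [Nat.card_sigma, h]

lemma IsPrecubic.ne_of_zero [Finite A] {σ α : Perm A} (h : IsPrecubic 0 σ α) (d : A) :
    σ d ≠ d := by
  intro hd
  have := h.leaves
  rw [Finite.card_eq_zero_iff] at this
  exact this.elim ⟨d, hd⟩

/-- A one-face cubic map on `N` darts has `N / 2 - 1` darts ascending along their vertex. -/
lemma IsPrecubic.two_mul_sum_ascents [Fintype A] [Nonempty A] {σ α : Perm A}
    (h : IsPrecubic 0 σ α) {p : A → ℕ} (hp : IsPosition (σ * α) p) :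
    2 * (∑ d, if p d < p (σ d) then 1 else 0) + 2 = Nat.card A := by
  classical
  obtain ⟨w, hw⟩ : ∃ w, p w + 1 = Nat.card A := by
    obtain ⟨w, hw⟩ := Finite.exists_max p
    refine ⟨w, by_contra fun hn => ?_⟩
    have := hp.step w
    rw [if_neg hn] at this
    have := hw ((σ * α) w)
    omega
  have h1 : ∀ d, (if p d < p (α d) then 1 else 0) =
      (if p d < p (σ d) then 1 else 0) + (if d = α w then 1 else 0) := by
    intro d
    have hs := hp.step (α d)
    rw [Perm.mul_apply, h.invol] at hs
    have hne := hp.inj.ne (h.fpf d)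
    have := hp.lt d
    by_cases hd : d = α w
    · have : α d = w := by rw [hd, h.invol]
      rw [this] at hs hne ⊢
      rw [if_pos hw] at hs
      rw [if_pos (by omega), if_neg (by omega), if_pos hd]
    · have : p (α d) ≠ p w := fun h' => hd (by rw [← hp.inj h', h.invol])
      rw [if_neg (by omega)] at hs
      rw [if_neg hd, hs]
      split_ifs <;> omega
  have h2 : ∑ d, (if p d < p (α d) then 1 else 0) = (∑ d, if p d < p (σ d) then 1 else 0) + 1 := by
    simp_rw [h1, Finset.sum_add_distrib]
    simp
  have h3 : ∑ d, (if p d < p (α d) then 1 else 0) = ∑ d, if p (α d) < p d then 1 else 0 := by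
    rw [← Equiv.sum_comp α]
    simp_rw [h.invol]
  have h4 : ∑ d, (if p d < p (α d) then 1 else 0) + ∑ d, (if p (α d) < p d then 1 else 0)
      = Nat.card A := by
    rw [← Finset.sum_add_distrib, Nat.card_eq_fintype_card, Fintype.card_eq_sum_ones]
    refine Finset.sum_congr rfl fun d _ => ?_
    have := hp.inj.ne (h.fpf d)
    split_ifs <;> omega
  omega

variable [DecidableEq A]

/-- The dart `a` lies on a vertex which can be cut into three leaves keeping a single face. -/
def IsReversed (σ α : Perm A) (a : A) : Prop :=
  IsFullCycle ((triCycle a (σ a) (σ (σ a)))⁻¹ * (σ * α))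

lemma IsPrecubic.two_mul_card_isReversed [Finite A] [Nonempty A] {σ α : Perm A}
    (h : IsPrecubic 0 σ α) : 2 * Nat.card {a // IsReversed σ α a} = Nat.card A + 6 := by
  classical
  have := Fintype.ofFinite A
  obtain ⟨p, hp⟩ := h.full.exists_isPosition
  have key : ∀ a, (if IsReversed σ α a then 1 else 0) + ((if p a < p (σ a) then 1 else 0) +
      (if p (σ a) < p (σ (σ a)) then 1 else 0) +
      (if p (σ (σ a)) < p (σ (σ (σ a))) then 1 else 0)) = 2 := by
    intro a
    have h1 : a ≠ σ a := (h.ne_of_zero a).symm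
    have h2 : σ a ≠ σ (σ a) := (h.ne_of_zero _).symm
    have h3 : a ≠ σ (σ a) := by
      have := h.ne_of_zero (σ (σ a))
      rwa [h.cube] at this
    have hr := hp.isFullCycle_triCycle_mul_iff h3 h1 h2.symm
    rw [← triCycle_inv h1 h3 h2] at hr
    change IsReversed σ α a ↔ _ at hr
    rw [h.cube]
    simp only [hr]
    have := hp.inj.ne h1
    have := hp.inj.ne h2
    have := hp.inj.ne h3
    split_ifs <;> omega
  have hsum := Finset.sum_congr (rfl : (Finset.univ : Finset A) = _) fun a _ => key a
  simp only [Finset.sum_add_distrib] at hsum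
  have e1 := Equiv.sum_comp σ fun a => if p a < p (σ a) then 1 else 0
  have e2 := Equiv.sum_comp σ fun a => if p (σ a) < p (σ (σ a)) then 1 else 0
  have e3 := h.two_mul_sum_ascents hp
  have e4 : Nat.card {a // IsReversed σ α a} = ∑ a, if IsReversed σ α a then 1 else 0 := by
    rw [Nat.card_eq_fintype_card, Fintype.card_subtype, Finset.card_filter]
  simp only [Finset.sum_const, Finset.card_univ, smul_eq_mul] at hsum
  have := Nat.card_eq_fintype_card (α := A)
  omega

lemma exists_of_card_fixed_eq_three [Finite A] {σ : Perm A} (h : Nat.card {d // σ d = d} = 3)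
    {a : A} (ha : σ a = a) :
    ∃ b c, a ≠ b ∧ a ≠ c ∧ b ≠ c ∧ ∀ d, σ d = d ↔ d = a ∨ d = b ∨ d = c := by
  classical
  have := Fintype.ofFinite A
  rw [Nat.card_eq_fintype_card, Fintype.card_subtype] at h
  have h2 := Finset.card_erase_of_mem (s := {d | σ d = d}) (a := a) (by simpa using ha)
  rw [h] at h2
  obtain ⟨b, c, hbc, hs⟩ := Finset.card_eq_two.1 h2
  have hm : ∀ d, (d ≠ a ∧ σ d = d) ↔ d = b ∨ d = c := by
    intro d
    simpa using congrArg (d ∈ ·) hs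
  refine ⟨b, c, ?_, ?_, hbc, fun d => ?_⟩
  · exact (((hm b).2 (.inl rfl)).1).symm
  · exact (((hm c).2 (.inr rfl)).1).symm
  · by_cases hd : d = a
    · simp [hd, ha]
    · simpa [hd] using hm d

lemma card_fixed_eq_three {σ : Perm A} {a b c : A} (hab : a ≠ b) (hac : a ≠ c) (hbc : b ≠ c)
    (h : ∀ d, σ d = d ↔ d = a ∨ d = b ∨ d = c) : Nat.card {d // σ d = d} = 3 := by
  have : {d | σ d = d} = (({a, b, c} : Finset A) : Set A) := by ext d; simp [h]
  change Nat.card ({d | σ d = d} : Set A) = 3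
  rw [this, Nat.card_coe_set_eq, Set.ncard_coe_finset]
  exact Finset.card_eq_three.2 ⟨a, b, c, hab, hac, hbc, rfl⟩

lemma IsPrecubic.glue [Finite A] {σ α : Perm A} {a b c : A} (h : IsPrecubic 3 σ α) (hab : a ≠ b)
    (hac : a ≠ c) (hbc : b ≠ c) (hfix : ∀ d, σ d = d ↔ d = a ∨ d = b ∨ d = c)
    (hfull : IsFullCycle (triCycle a b c * (σ * α))) :
    IsPrecubic 0 (triCycle a b c * σ) α := by
  have fa : (triCycle a b c * σ) a = b := by
    rw [Perm.mul_apply, (hfix a).2 (by simp), triCycle_fst hab hac]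
  have fb : (triCycle a b c * σ) b = c := by
    rw [Perm.mul_apply, (hfix b).2 (by simp), triCycle_snd hac hbc]
  have fc : (triCycle a b c * σ) c = a := by
    rw [Perm.mul_apply, (hfix c).2 (by simp), triCycle_trd]
  have fd : ∀ d, σ d ≠ d → (triCycle a b c * σ) d = σ d := by
    intro d hd
    have : ¬ (σ (σ d) = σ d) := fun h' => hd (σ.injective h')
    rw [hfix] at this
    push Not at this
    rw [Perm.mul_apply, triCycle_of_ne this.1 this.2.1 this.2.2]
  refine ⟨h.invol, h.fpf, fun d => ?_, hfull, ?_⟩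
  · by_cases hd : σ d = d
    · rcases (hfix d).1 hd with rfl | rfl | rfl <;> simp only [fa, fb, fc]
    · have h1 : σ (σ d) ≠ σ d := fun h' => hd (σ.injective h')
      have h2 : σ (σ (σ d)) ≠ σ (σ d) := fun h' => h1 (σ.injective h')
      rw [fd d hd, fd _ h1, fd _ h2, h.cube]
  · rw [Finite.card_eq_zero_iff]
    refine ⟨fun ⟨d, hd'⟩ => ?_⟩
    by_cases hd : σ d = d
    · rcases (hfix d).1 hd with rfl | rfl | rfl <;> simp_all
    · rw [fd d hd] at hd'
      exact hd hd'

lemma IsPrecubic.cut_fixed_iff [Finite A] {σ α : Perm A} (h : IsPrecubic 0 σ α) (a d : A) :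
    ((triCycle a (σ a) (σ (σ a)))⁻¹ * σ) d = d ↔ d = a ∨ d = σ a ∨ d = σ (σ a) := by
  have h1 : a ≠ σ a := (h.ne_of_zero a).symm
  have h2 : σ a ≠ σ (σ a) := (h.ne_of_zero _).symm
  have h3 : a ≠ σ (σ a) := by
    have := h.ne_of_zero (σ (σ a))
    rwa [h.cube] at this
  rw [Perm.mul_apply, Perm.inv_eq_iff_eq]
  constructor
  · intro hd
    by_contra hn
    push Not at hn
    rw [triCycle_of_ne hn.1 hn.2.1 hn.2.2] at hd
    exact h.ne_of_zero d hd
  · rintro (rfl | rfl | rfl)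
    · rw [triCycle_fst h1 h3]
    · rw [triCycle_snd h3 h2]
    · rw [triCycle_trd, h.cube]

lemma IsPrecubic.cut [Finite A] {σ α : Perm A} {a : A} (h : IsPrecubic 0 σ α)
    (ha : IsReversed σ α a) :
    IsPrecubic 3 ((triCycle a (σ a) (σ (σ a)))⁻¹ * σ) α := by
  have h1 : a ≠ σ a := (h.ne_of_zero a).symm
  have h2 : σ a ≠ σ (σ a) := (h.ne_of_zero _).symm
  have h3 : a ≠ σ (σ a) := by
    have := h.ne_of_zero (σ (σ a))
    rwa [h.cube] at this
  have hfix := h.cut_fixed_iff a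
  set σ' := (triCycle a (σ a) (σ (σ a)))⁻¹ * σ with hσ'
  have fd : ∀ d, σ' d ≠ d → σ' d = σ d := by
    intro d hd
    rw [hσ', Perm.mul_apply, Perm.inv_eq_iff_eq]
    rw [Ne, hfix] at hd
    push Not at hd
    obtain ⟨u, v, w⟩ := hd
    refine (triCycle_of_ne ?_ (σ.injective.ne u) (σ.injective.ne v)).symm
    intro h'
    apply w
    rw [← h', h.cube]
  refine ⟨h.invol, h.fpf, fun d => ?_, ha, card_fixed_eq_three h1 h3 h2 hfix⟩
  by_cases hd : σ' d = d
  · rw [hd, hd, hd]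
  · have e1 : σ' (σ' d) ≠ σ' d := fun h' => hd (σ'.injective h')
    have e2 : σ' (σ' (σ' d)) ≠ σ' (σ' d) := fun h' => e1 (σ'.injective h')
    rw [fd _ e2, fd _ e1, fd d hd, h.cube]

/-- Cutting a reversed vertex of a one-face cubic map into three leaves is a bijection. -/
lemma card_reversed_eq_card_leaf [Finite A] :
    Nat.card (Σ x : PrecubicMap 0 A, {a // IsReversed x.1.1 x.1.2 a}) =
      Nat.card (Σ x : PrecubicMap 3 A, {a // x.1.1 a = a}) := by
  let Φ : (Σ x : PrecubicMap 0 A, {a // IsReversed x.1.1 x.1.2 a}) →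
      Σ x : PrecubicMap 3 A, {a // x.1.1 a = a} := fun y =>
    ⟨⟨(_, y.1.1.2), y.1.2.cut y.2.2⟩, y.2.1, (y.1.2.cut_fixed_iff y.2.1 _).2 (.inl rfl)⟩
  refine Nat.card_congr (Equiv.ofBijective Φ ⟨?_, ?_⟩)
  · rintro ⟨⟨⟨σ₁, α₁⟩, h₁⟩, a₁, ha₁⟩ ⟨⟨⟨σ₂, α₂⟩, h₂⟩, a₂, ha₂⟩ heq
    dsimp only at h₁ h₂ ha₁ ha₂
    have hx : ((triCycle a₁ (σ₁ a₁) (σ₁ (σ₁ a₁)))⁻¹ * σ₁, α₁) =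
        ((triCycle a₂ (σ₂ a₂) (σ₂ (σ₂ a₂)))⁻¹ * σ₂, α₂) := congrArg (fun y => y.1.1) heq
    have ha : a₁ = a₂ := congrArg (fun y => (y.2.1 : A)) heq
    subst ha
    obtain ⟨hσ, rfl⟩ := Prod.ext_iff.1 hx
    dsimp only at hσ
    have f₁ := h₁.cut_fixed_iff a₁
    have f₂ := h₂.cut_fixed_iff a₁
    rw [← hσ] at f₂
    have d1 : a₁ ≠ σ₁ a₁ := (h₁.ne_of_zero a₁).symm
    have d2 : σ₁ a₁ ≠ σ₁ (σ₁ a₁) := (h₁.ne_of_zero _).symm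
    have d3 : a₁ ≠ σ₁ (σ₁ a₁) := by
      have := h₁.ne_of_zero (σ₁ (σ₁ a₁))
      rwa [h₁.cube] at this
    have d4 : a₁ ≠ σ₂ a₁ := (h₂.ne_of_zero a₁).symm
    have d5 : σ₂ a₁ ≠ σ₂ (σ₂ a₁) := (h₂.ne_of_zero _).symm
    have d6 : a₁ ≠ σ₂ (σ₂ a₁) := by
      have := h₂.ne_of_zero (σ₂ (σ₂ a₁))
      rwa [h₂.cube] at this
    have m1 := (f₁ _).1 ((f₂ (σ₂ a₁)).2 (.inr (.inl rfl)))
    have m2 := (f₁ _).1 ((f₂ (σ₂ (σ₂ a₁))).2 (.inr (.inr rfl)))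
    rcases m1.resolve_left d4.symm with e1 | e1
    · have e2 := (m2.resolve_left d6.symm).resolve_left (by rw [← e1]; exact d5.symm)
      rw [e2, e1] at hσ
      obtain rfl := mul_left_cancel hσ
      rfl
    · have e2 := (m2.resolve_left d6.symm).resolve_right (by rw [← e1]; exact d5.symm)
      exfalso
      obtain ⟨p, hp⟩ := IsFullCycle.exists_isPosition ha₁
      have g1 : IsFullCycle (triCycle a₁ (σ₁ a₁) (σ₁ (σ₁ a₁)) *
          ((triCycle a₁ (σ₁ a₁) (σ₁ (σ₁ a₁)))⁻¹ * (σ₁ * α₁))) := by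
        simpa using h₁.full
      have g2 : IsFullCycle (triCycle a₁ (σ₁ (σ₁ a₁)) (σ₁ a₁) *
          ((triCycle a₁ (σ₁ a₁) (σ₁ (σ₁ a₁)))⁻¹ * (σ₁ * α₁))) := by
        rw [← mul_assoc _ σ₁, hσ, e2, e1]
        simpa [mul_assoc] using h₂.full
      rw [hp.isFullCycle_triCycle_mul_iff d1 d3 d2] at g1
      rw [hp.isFullCycle_triCycle_mul_iff d3 d1 d2.symm] at g2
      omega
  · rintro ⟨⟨⟨σ, α⟩, h⟩, a, ha⟩
    dsimp only at h ha
    obtain ⟨b, c, hab, hac, hbc, hfix⟩ := exists_of_card_fixed_eq_three h.leaves ha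
    obtain ⟨p, hp⟩ := h.full.exists_isPosition
    wlog hfull : IsFullCycle (triCycle a b c * (σ * α)) generalizing b c
    · refine this c b hac hab hbc.symm (fun d => by rw [hfix]; tauto) ?_
      rw [hp.isFullCycle_triCycle_mul_iff hab hac hbc] at hfull
      rw [hp.isFullCycle_triCycle_mul_iff hac hab hbc.symm]
      have := hp.inj.ne hab
      have := hp.inj.ne hac
      have := hp.inj.ne hbc
      omega
    have fa : (triCycle a b c * σ) a = b := by
      rw [Perm.mul_apply, ha, triCycle_fst hab hac]
    have fb : (triCycle a b c * σ) b = c := by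
      rw [Perm.mul_apply, (hfix b).2 (by simp), triCycle_snd hac hbc]
    refine ⟨⟨⟨(triCycle a b c * σ, α), h.glue hab hac hbc hfix hfull⟩, a, ?_⟩, ?_⟩
    · dsimp only [IsReversed]
      rw [fa, fb]
      simpa [mul_assoc] using h.full
    · dsimp only [Φ]
      have : (triCycle a ((triCycle a b c * σ) a)
          ((triCycle a b c * σ) ((triCycle a b c * σ) a)))⁻¹ * (triCycle a b c * σ) = σ := by
        rw [fa, fb]
        simp
      refine Sigma.subtype_ext (Subtype.ext (Prod.ext this rfl)) rfl

theorem card_precubicMap_zero [Finite A] [Nonempty A] :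
    (Nat.card A + 6) * Nat.card (PrecubicMap 0 A) = 6 * Nat.card (PrecubicMap 3 A) := by
  have h1 : Nat.card (Σ x : PrecubicMap 0 A, {a // IsReversed x.1.1 x.1.2 a}) =
      Nat.card (PrecubicMap 0 A) * ((Nat.card A + 6) / 2) :=
    Nat.card_sigma_of_const fun x => by
      have := x.2.two_mul_card_isReversed
      omega
  have h2 : Nat.card (Σ x : PrecubicMap 3 A, {a // x.1.1 a = a}) =
      Nat.card (PrecubicMap 3 A) * 3 := Nat.card_sigma_of_const fun x => x.2.leaves
  rw [card_reversed_eq_card_leaf, h2] at h1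
  rcases isEmpty_or_nonempty (PrecubicMap 0 A) with _ | ⟨⟨x⟩⟩
  · simp only [Nat.card_of_isEmpty, zero_mul] at h1 ⊢
    omega
  · have h3 := x.2.two_mul_card_isReversed
    have : (Nat.card A + 6) = 2 * ((Nat.card A + 6) / 2) := by omega
    rw [this, mul_assoc, mul_comm _ (Nat.card (PrecubicMap 0 A)), ← h1]
    ring

end Precubic

section Transport

variable {A B : Type}

lemma IsFullCycle.permCongr {γ : Perm A} (h : IsFullCycle γ) (e : A ≃ B) :
    IsFullCycle (e.permCongr γ) :=
  h.of_surjective e e.surjective fun z => ⟨1, by simp⟩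

lemma IsPrecubic.permCongr {k : ℕ} {σ α : Perm A} (h : IsPrecubic k σ α) (e : A ≃ B) :
    IsPrecubic k (e.permCongr σ) (e.permCongr α) where
  invol d := by simp [h.invol]
  fpf d hd := by
    rw [permCongr_apply, ← eq_symm_apply] at hd
    exact h.fpf _ hd
  cube d := by simp [h.cube]
  full := by
    have := h.full.permCongr e
    convert this using 1
    ext d
    simp
  leaves := by
    rw [← h.leaves]
    refine Nat.card_congr (e.symm.subtypeEquiv fun d => ?_)
    rw [permCongr_apply, ← eq_symm_apply]

lemma isPrecubic_permCongr_iff {k : ℕ} {σ α : Perm A} (e : A ≃ B) :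
    IsPrecubic k (e.permCongr σ) (e.permCongr α) ↔ IsPrecubic k σ α := by
  refine ⟨fun h => ?_, fun h => h.permCongr e⟩
  have := h.permCongr e.symm
  rwa [← permCongr_symm, symm_apply_apply, symm_apply_apply] at this

end Transport

section Leaf

variable {A B : Type}

/-- `t 3` is a leaf attached to the vertex `t 2 ↦ t 1 ↦ t 0 ↦ t 2`. -/
structure IsPrecubicWithLeaf (k : ℕ) (t : Fin 4 → A) (σ α : Perm A) : Prop where
  precubic : IsPrecubic k σ α
  fst : σ (t 3) = t 3
  adj : α (t 3) = t 2
  snd : σ (t 2) = t 1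
  trd : σ (t 1) = t 0

/-- The rotation of the four darts deleted together with a leaf. -/
def leafRotation : Perm (Fin 4) := swap 2 1 * swap 1 0

/-- The edges formed by the four darts deleted together with a leaf, before they are attached. -/
def leafEdges : Perm (Fin 4) := swap 2 3 * swap 1 0

lemma Equiv.Perm.exists_eq_sumCongr {ι : Type} {σ : Perm (B ⊕ ι)} {c : Perm ι}
    (h : ∀ i, σ (.inr i) = .inr (c i)) [Finite B] : ∃ σ' : Perm B, σ = σ'.sumCongr c := by
  have hl : ∀ b, ∃ b', σ (.inl b) = .inl b' := by
    intro b
    rcases hb : σ (.inl b) with b' | i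
    · exact ⟨b', rfl⟩
    · have := h (c.symm i)
      rw [apply_symm_apply, ← hb] at this
      simpa using σ.injective this
  choose f hf using hl
  have hinj : Function.Injective f := fun x y hxy => by
    have : σ (.inl x) = σ (.inl y) := by rw [hf, hf, hxy]
    simpa using σ.injective this
  refine ⟨Equiv.ofBijective f (Finite.injective_iff_bijective.1 hinj), ?_⟩
  ext (b | i)
  · simp [hf]
  · simp [h]

variable [DecidableEq B]

/-- Subdivide the edge of `d` and attach a leaf on its side. -/
def attachLeaf (α : Perm B) (d : B) : Perm (B ⊕ Fin 4) :=
  swap (.inr 1) (.inl d) * α.sumCongr leafEdges * swap (.inr 1) (.inl d)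

section
variable {α : Perm B} {d : B}

lemma attachLeaf_zero : attachLeaf α d (.inr 0) = .inl d := by
  simp [attachLeaf, leafEdges, swap_apply_of_ne_of_ne]

lemma attachLeaf_one (hd : α d ≠ d) : attachLeaf α d (.inr 1) = .inl (α d) := by
  simp [attachLeaf, swap_apply_of_ne_of_ne, hd]

lemma attachLeaf_two : attachLeaf α d (.inr 2) = .inr 3 := by
  simp [attachLeaf, leafEdges, swap_apply_of_ne_of_ne]

lemma attachLeaf_three : attachLeaf α d (.inr 3) = .inr 2 := by
  simp [attachLeaf, leafEdges, swap_apply_of_ne_of_ne]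

lemma attachLeaf_inl_self : attachLeaf α d (.inl d) = .inr 0 := by
  simp [attachLeaf, leafEdges, swap_apply_of_ne_of_ne]

lemma attachLeaf_inl_adj {e : B} (he : e ≠ d) (h : α e = d) :
    attachLeaf α d (.inl e) = .inr 1 := by
  simp [attachLeaf, swap_apply_of_ne_of_ne, he, h]

lemma attachLeaf_inl_of_ne {e : B} (he : e ≠ d) (h : α e ≠ d) :
    attachLeaf α d (.inl e) = .inl (α e) := by
  simp [attachLeaf, swap_apply_of_ne_of_ne, he, h]

lemma attachLeaf_invol_iff :
    (∀ e, attachLeaf α d (attachLeaf α d e) = e) ↔ ∀ e, α (α e) = e := by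
  have hβ : ∀ i, leafEdges (leafEdges i) = i := by decide
  constructor
  · intro h e
    have := h (swap (.inr 1) (.inl d) (.inl e))
    simpa [attachLeaf] using this
  · intro h e
    have : ∀ z, (α.sumCongr leafEdges) ((α.sumCongr leafEdges) z) = z := by
      rintro (z | z) <;> simp [h, hβ]
    simp only [attachLeaf, Perm.mul_apply, swap_apply_self, this]

lemma attachLeaf_fpf_iff : (∀ e, attachLeaf α d e ≠ e) ↔ ∀ e, α e ≠ e := by
  have hβ : ∀ i, leafEdges i ≠ i := by decide
  constructor
  · intro h e he
    have := h (swap (.inr 1) (.inl d) (.inl e))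
    simp [attachLeaf, he] at this
  · intro h e he
    have h1 : ∀ z, (α.sumCongr leafEdges) z ≠ z := by
      rintro (z | z) <;> simp [h, hβ]
    apply h1 (swap (.inr 1) (.inl d) e)
    rwa [attachLeaf, Perm.mul_apply, Perm.mul_apply, swap_apply_eq_iff] at he

lemma isFullCycle_attachLeaf_iff {σ : Perm B} (hα : ∀ e, α (α e) = e) (hf : ∀ e, α e ≠ e) :
    IsFullCycle (σ.sumCongr leafRotation * attachLeaf α d) ↔ IsFullCycle (σ * α) := by
  have hc : leafRotation 0 = 2 ∧ leafRotation 1 = 0 ∧ leafRotation 2 = 1 ∧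
    leafRotation 3 = 3 := by decide
  obtain ⟨c0, c1, c2, c3⟩ := hc
  set γ := σ.sumCongr leafRotation * attachLeaf α d with hγ
  have g0 : γ (.inr 0) = .inl (σ d) := by simp [hγ, attachLeaf_zero]
  have g1 : γ (.inr 1) = .inl (σ (α d)) := by simp [hγ, attachLeaf_one (hf d)]
  have g2 : γ (.inr 2) = .inr 3 := by simp [hγ, attachLeaf_two, c3]
  have g3 : γ (.inr 3) = .inr 1 := by simp [hγ, attachLeaf_three, c2]
  have gd : γ (.inl d) = .inr 2 := by simp [hγ, attachLeaf_inl_self, c0]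
  have ga : ∀ e, e ≠ d → α e = d → γ (.inl e) = .inr 0 := by
    intro e he h
    simp [hγ, attachLeaf_inl_adj he h, c1]
  have gn : ∀ e, e ≠ d → α e ≠ d → γ (.inl e) = .inl (σ (α e)) := by
    intro e he h
    simp [hγ, attachLeaf_inl_of_ne he h]
  have step : ∀ z, γ.SameCycle z (γ z) := fun z => ⟨1, by simp⟩
  constructor
  · intro h
    refine h.of_surjective (Sum.elim id ![α d, d, d, d]) (fun b => ⟨.inl b, rfl⟩) ?_
    rintro (e | i)
    · by_cases h1 : e = d
      · subst h1
        rw [gd]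
        exact Perm.SameCycle.refl _ _
      by_cases h2 : α e = d
      · rw [ga e h1 h2, ← h2]
        simp [hα, Perm.SameCycle.refl]
      · rw [gn e h1 h2]
        exact ⟨1, by simp⟩
    · fin_cases i
      · simp only [Fin.zero_eta, g0]
        exact ⟨1, by simp [hα]⟩
      · simp only [Fin.mk_one, g1]
        exact ⟨1, by simp⟩
      · simp only [Fin.reduceFinMk, g2]
        exact Perm.SameCycle.refl _ _
      · simp only [Fin.reduceFinMk, g3]
        exact Perm.SameCycle.refl _ _
  · intro h
    have s2 : γ.SameCycle (.inl d) (.inr 2) := gd ▸ step (.inl d)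
    have s3 : γ.SameCycle (.inl d) (.inr 3) := s2.trans (g2 ▸ step (.inr 2))
    have s1 : γ.SameCycle (.inl d) (.inr 1) := s3.trans (g3 ▸ step (.inr 3))
    have s0 : γ.SameCycle (.inl (α d)) (.inr 0) := ga (α d) (hf d) (hα d) ▸ step (.inl (α d))
    have hl : ∀ x y, γ.SameCycle (.inl x) (.inl y) := by
      intro x y
      refine (h x y).map_of_step (f := Sum.inl) fun e => ?_
      rw [Perm.mul_apply]
      by_cases h1 : e = d
      · subst h1
        exact s1.trans (g1 ▸ step (.inr 1))
      by_cases h2 : α e = d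
      · have := step (.inr 0)
        rw [g0, ← h2] at this
        rw [← h2, hα] at s0
        exact s0.trans this
      · exact gn e h1 h2 ▸ step (.inl e)
    have all : ∀ z, γ.SameCycle (.inl d) z := by
      rintro (e | i)
      · exact hl _ _
      · fin_cases i
        · exact (hl _ _).trans s0
        · exact s1
        · exact s2
        · exact s3
    exact fun x y => (all x).symm.trans (all y)

omit [DecidableEq B] in
lemma card_fixed_sumCongr_leafRotation [Finite B] (σ : Perm B) :
    Nat.card {e // σ.sumCongr leafRotation e = e} = Nat.card {e // σ e = e} + 1 := by
  have h1 : Nat.card {i // leafRotation i = i} = 1 := by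
    rw [Nat.card_eq_fintype_card]; decide
  rw [Nat.card_congr (Equiv.subtypeSum ..), Nat.card_sum, ← h1]
  simp

lemma isPrecubic_attachLeaf_iff [Finite B] {k : ℕ} {σ : Perm B} :
    IsPrecubic (k + 1) (σ.sumCongr leafRotation) (attachLeaf α d) ↔ IsPrecubic k σ α := by
  have hc : ∀ i, leafRotation (leafRotation (leafRotation i)) = i := by decide
  have h3 : (∀ e, σ.sumCongr leafRotation (σ.sumCongr leafRotation (σ.sumCongr leafRotation e)) = e)
      ↔ ∀ e, σ (σ (σ e)) = e := by
    simp [Sum.forall, hc]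
  constructor
  · intro h
    have i := attachLeaf_invol_iff.1 h.invol
    have f := attachLeaf_fpf_iff.1 h.fpf
    have l := h.leaves
    rw [card_fixed_sumCongr_leafRotation] at l
    exact ⟨i, f, h3.1 h.cube, (isFullCycle_attachLeaf_iff i f).1 h.full, by omega⟩
  · intro h
    refine ⟨attachLeaf_invol_iff.2 h.invol, attachLeaf_fpf_iff.2 h.fpf, h3.2 h.cube,
      (isFullCycle_attachLeaf_iff h.invol h.fpf).2 h.full, ?_⟩
    rw [card_fixed_sumCongr_leafRotation, h.leaves]

lemma IsPrecubicWithLeaf.exists_attachLeaf [Finite B] {k : ℕ} {σ α : Perm (B ⊕ Fin 4)}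
    (h : IsPrecubicWithLeaf k Sum.inr σ α) :
    ∃ (σ' α' : Perm B) (d : B), σ = σ'.sumCongr leafRotation ∧ α = attachLeaf α' d := by
  obtain ⟨h, hl, ha, h2, h1⟩ := h
  have h0 : σ (.inr 0) = .inr 2 := by rw [← h1, ← h2, h.cube]
  have ha' : α (.inr 2) = .inr 3 := by rw [← ha, h.invol]
  have hc : leafRotation 0 = 2 ∧ leafRotation 1 = 0 ∧ leafRotation 2 = 1 ∧
    leafRotation 3 = 3 := by decide
  have hb : leafEdges 0 = 1 ∧ leafEdges 1 = 0 ∧ leafEdges 2 = 3 ∧ leafEdges 3 = 2 := by decide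
  obtain ⟨c0, c1, c2, c3⟩ := hc
  obtain ⟨b0, b1, b2, b3⟩ := hb
  obtain ⟨σ', hσ⟩ := Perm.exists_eq_sumCongr (σ := σ) (c := leafRotation) (by
    intro i
    fin_cases i
    · simpa [c0] using h0
    · simpa [c1] using h1
    · simpa [c2] using h2
    · simpa [c3] using hl)
  obtain ⟨d, hd⟩ : ∃ d, α (.inr 0) = .inl d := by
    rcases hd : α (.inr 0) with d | i
    · exact ⟨d, rfl⟩
    exfalso
    have hi := h.invol (.inr 0)
    rw [hd] at hi
    fin_cases i
    · exact h.fpf _ hd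
    · have := h.full.mem_of_mapsTo (S := {.inr 0}) (by
        rintro x rfl
        rw [Perm.mul_apply, hd]
        simpa using h1) rfl (.inr 1)
      simp at this
    · simp only [Fin.reduceFinMk, ha'] at hi
      simp at hi
    · simp only [Fin.reduceFinMk, ha] at hi
      simp at hi
  have hd' : α (.inl d) = .inr 0 := by rw [← hd, h.invol]
  obtain ⟨α', hα⟩ := Perm.exists_eq_sumCongr (c := leafEdges)
    (σ := swap (.inr 1) (.inl d) * α * swap (.inr 1) (.inl d)) (by
    intro i
    fin_cases i
    · simp [swap_apply_of_ne_of_ne, hd, b0]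
    · simp [swap_apply_of_ne_of_ne, hd', b1]
    · simp [swap_apply_of_ne_of_ne, ha', b2]
    · simp [swap_apply_of_ne_of_ne, ha, b3])
  refine ⟨σ', α', d, hσ, ?_⟩
  rw [attachLeaf, ← hα]
  simp [mul_assoc]

end

lemma card_isPrecubicWithLeaf_inr [Finite B] (k : ℕ) :
    Nat.card {x : Perm (B ⊕ Fin 4) × Perm (B ⊕ Fin 4) //
      IsPrecubicWithLeaf (k + 1) Sum.inr x.1 x.2} = Nat.card (PrecubicMap k B) * Nat.card B := by
  have hc : leafRotation 2 = 1 ∧ leafRotation 1 = 0 ∧ leafRotation 3 = 3 := by decide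
  rw [← Nat.card_prod]
  symm
  refine Nat.card_congr (Equiv.ofBijective (fun y =>
    ⟨(y.1.1.1.sumCongr leafRotation, attachLeaf y.1.1.2 y.2),
      isPrecubic_attachLeaf_iff.2 y.1.2, ?_, attachLeaf_three, ?_, ?_⟩) ⟨?_, ?_⟩)
  · simp [hc]
  · simp [hc]
  · simp [hc]
  · rintro ⟨⟨⟨σ₁, α₁⟩, h₁⟩, d₁⟩ ⟨⟨⟨σ₂, α₂⟩, h₂⟩, d₂⟩ h
    simp only [Subtype.mk.injEq, Prod.mk.injEq] at h
    obtain ⟨hσ, hα⟩ := h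
    have hd : d₁ = d₂ := by
      have := Equiv.congr_fun hα (.inr 0)
      rw [attachLeaf_zero, attachLeaf_zero] at this
      simpa using this
    subst hd
    rw [attachLeaf, attachLeaf] at hα
    have hα' := mul_left_cancel (mul_right_cancel hα)
    have e1 : σ₁ = σ₂ := by
      ext b
      simpa using Equiv.congr_fun hσ (.inl b)
    have e2 : α₁ = α₂ := by
      ext b
      simpa using Equiv.congr_fun hα' (.inl b)
    subst e1 e2
    rfl
  · rintro ⟨⟨σ, α⟩, h⟩
    obtain ⟨σ', α', d, rfl, rfl⟩ := h.exists_attachLeaf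
    exact ⟨(⟨(σ', α'), isPrecubic_attachLeaf_iff.1 h.precubic⟩, d), rfl⟩

omit [DecidableEq B] in
lemma isPrecubicWithLeaf_permCongr_iff {k : ℕ} {t : Fin 4 → A} {σ α : Perm A} (e : A ≃ B) :
    IsPrecubicWithLeaf k (e ∘ t) (e.permCongr σ) (e.permCongr α) ↔
      IsPrecubicWithLeaf k t σ α := by
  constructor
  · rintro ⟨h, h1, h2, h3, h4⟩
    exact ⟨(isPrecubic_permCongr_iff e).1 h, by simpa using h1, by simpa using h2,
      by simpa using h3, by simpa using h4⟩
  · rintro ⟨h, h1, h2, h3, h4⟩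
    exact ⟨h.permCongr e, by simpa using h1, by simpa using h2,
      by simpa using h3, by simpa using h4⟩

lemma card_isPrecubicWithLeaf [Finite A] [Finite B] (hAB : Nat.card A = Nat.card B + 4) (k : ℕ)
    (t : Fin 4 ↪ A) :
    Nat.card {x : Perm A × Perm A // IsPrecubicWithLeaf (k + 1) t x.1 x.2} =
      Nat.card (PrecubicMap k B) * Nat.card B := by
  classical
  have h1 : Nat.card B = Nat.card ↥(Set.range t)ᶜ := by
    have := Nat.card_congr (Equiv.Set.sumCompl (Set.range t))
    rw [Nat.card_sum, Nat.card_range_of_injective t.injective, Nat.card_fin] at this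
    omega
  let e : B ⊕ Fin 4 ≃ A :=
    (Equiv.sumCongr (Finite.card_eq.1 h1).some (Equiv.ofInjective t t.injective)).trans
      ((Equiv.sumComm _ _).trans (Equiv.Set.sumCompl (Set.range t)))
  have he : e ∘ Sum.inr = t := by ext i; simp [e]
  rw [← card_isPrecubicWithLeaf_inr]
  refine (Nat.card_congr ((e.permCongr.prodCongr e.permCongr).subtypeEquiv fun x => ?_)).symm
  rw [← he]
  exact (isPrecubicWithLeaf_permCongr_iff e).symm

lemma card_leaf_eq [Finite A] (hA : 2 < Nat.card A) (k : ℕ) :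
    Nat.card (Σ x : PrecubicMap k A, {a // x.1.1 a = a}) =
      Nat.card (Σ t : Fin 4 ↪ A, {x : Perm A × Perm A // IsPrecubicWithLeaf k t x.1 x.2}) := by
  let Φ : (Σ t : Fin 4 ↪ A, {x : Perm A × Perm A // IsPrecubicWithLeaf k t x.1 x.2}) →
      (Σ x : PrecubicMap k A, {a // x.1.1 a = a}) := fun y =>
    ⟨⟨y.2.1, y.2.2.precubic⟩, y.1 3, y.2.2.fst⟩
  refine (Nat.card_congr (Equiv.ofBijective Φ ⟨?_, ?_⟩)).symm
  · rintro ⟨t₁, x₁, h₁⟩ ⟨t₂, x₂, h₂⟩ h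
    have hx : x₁ = x₂ := congrArg (fun y => y.1.1) h
    have h3 : t₁ 3 = t₂ 3 := congrArg (fun y => (y.2.1 : A)) h
    subst hx
    have h2 : t₁ 2 = t₂ 2 := by rw [← h₁.adj, ← h₂.adj, h3]
    have h1 : t₁ 1 = t₂ 1 := by rw [← h₁.snd, ← h₂.snd, h2]
    have h0 : t₁ 0 = t₂ 0 := by rw [← h₁.trd, ← h₂.trd, h1]
    have : t₁ = t₂ := by
      ext i
      fin_cases i <;> assumption
    subst this
    rfl
  · rintro ⟨⟨⟨σ, α⟩, h⟩, a, ha⟩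
    dsimp only at h ha
    have n1 : α a ≠ a := h.fpf a
    have n2 : σ (α a) ≠ α a := by
      intro h2
      classical
      have : ∀ b, b ∈ ({a, α a} : Set A) := h.full.mem_of_mapsTo (a := a) (by
        rintro x (rfl | rfl)
        · simp [h2]
        · simp [h.invol, ha]) (by simp)
      have hle : Nat.card A ≤ 2 := by
        rw [← Set.ncard_univ, ← Set.ncard_pair n1.symm]
        exact Set.ncard_le_ncard (fun b _ => this b)
      omega
    have n3 : σ (σ (α a)) ≠ σ (α a) := σ.injective.ne n2
    have n4 : σ (σ (α a)) ≠ α a := by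
      intro h4
      apply n2
      have := h.cube (α a)
      rwa [h4] at this
    have m1 : σ (α a) ≠ a := fun h' => n1 (σ.injective (h'.trans ha.symm))
    have m2 : σ (σ (α a)) ≠ a := fun h' => m1 (σ.injective (h'.trans ha.symm))
    let t : Fin 4 → A := ![σ (σ (α a)), σ (α a), α a, a]
    have ht : Function.Injective t := by
      intro i j hij
      fin_cases i <;> fin_cases j <;>
        simp [t, n1, n3, n4, m1, m2, n1.symm, n2, n2.symm, n3.symm, n4.symm, m1.symm,
          m2.symm] at hij ⊢
    exact ⟨⟨⟨t, ht⟩, (σ, α), h, ha, rfl, rfl, rfl⟩, rfl⟩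

/-- Removing a marked leaf, together with the edge and the vertex it is attached to. -/
theorem card_precubicMap_succ [Finite A] [Finite B] (hAB : Nat.card A = Nat.card B + 4) (k : ℕ) :
    (k + 1) * Nat.card (PrecubicMap (k + 1) A) =
      (Nat.card A).descFactorial 4 * (Nat.card B * Nat.card (PrecubicMap k B)) := by
  classical
  have := Fintype.ofFinite A
  have h1 := card_leaf_eq (A := A) (by omega) (k + 1)
  rw [Nat.card_sigma_of_const fun x : PrecubicMap (k + 1) A => x.2.leaves,
    Nat.card_sigma_of_const fun t => card_isPrecubicWithLeaf hAB k t,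
    Nat.card_eq_fintype_card (α := Fin 4 ↪ A), Fintype.card_embedding_eq, Fintype.card_fin,
    ← Nat.card_eq_fintype_card] at h1
  rw [mul_comm, h1, mul_comm (Nat.card B)]

end Leaf

section Count

lemma card_precubicMap_two_fin_two : Nat.card (PrecubicMap 2 (Fin 2)) = 1 := by
  have hswap : ∀ α : Perm (Fin 2), (∀ d, α d ≠ d) → α = swap 0 1 := by decide
  have hone : ∀ σ : Perm (Fin 2), Fintype.card {d // σ d = d} = 2 → σ = 1 := by decide
  rw [Nat.card_eq_one_iff_unique]
  refine ⟨⟨?_⟩, ⟨⟨(1, swap 0 1), by decide, by decide, by decide, ?_, by simp⟩⟩⟩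
  · rintro ⟨⟨σ₁, α₁⟩, h₁⟩ ⟨⟨σ₂, α₂⟩, h₂⟩
    have l₁ := h₁.leaves
    have l₂ := h₂.leaves
    rw [Nat.card_eq_fintype_card] at l₁ l₂
    simp only [Subtype.mk.injEq, Prod.mk.injEq]
    exact ⟨(hone _ l₁).trans (hone _ l₂).symm, (hswap _ h₁.fpf).trans (hswap _ h₂.fpf).symm⟩
  · unfold IsFullCycle
    decide

/-- The number of rooted precubic one-face maps on `n` darts with `k` leaves. -/
noncomputable def rootedCount (k n : ℕ) : ℚ :=
  Nat.card (PrecubicMap k (Fin n)) / (n - 1).factorial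

lemma rootedCount_succ (k n : ℕ) (hn : 1 ≤ n) :
    (k + 1) * rootedCount (k + 1) (n + 4) = (n + 4) * rootedCount k n := by
  have h := card_precubicMap_succ (A := Fin (n + 4)) (B := Fin n) (by simp) k
  rw [Nat.card_fin, Nat.card_fin] at h
  have h' := congrArg (Nat.cast : ℕ → ℚ) h
  have hd := Nat.factorial_mul_descFactorial (n := n + 4) (k := 4) (by omega)
  have hd' := congrArg (Nat.cast : ℕ → ℚ) hd
  obtain ⟨m, rfl⟩ : ∃ m, n = m + 1 := ⟨n - 1, by omega⟩
  unfold rootedCount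
  simp only [show m + 1 + 4 - 4 = m + 1 by omega, show m + 1 + 4 - 1 = m + 4 by omega,
    show m + 1 - 1 = m by omega] at hd' ⊢
  rw [show m + 1 + 4 = (m + 4) + 1 by omega, Nat.factorial_succ (m + 4),
    Nat.factorial_succ m] at hd'
  push_cast at h' hd' ⊢
  have f1 : (m.factorial : ℚ) ≠ 0 := by positivity
  have f2 : ((m + 4).factorial : ℚ) ≠ 0 := by positivity
  field_simp
  linear_combination (m.factorial : ℚ) * h' +
    (Nat.card (PrecubicMap k (Fin (m + 1))) : ℚ) * hd'

lemma rootedCount_zero (n : ℕ) (hn : 1 ≤ n) :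
    (n + 6) * rootedCount 0 n = 6 * rootedCount 3 n := by
  have : NeZero n := ⟨by omega⟩
  have h := congrArg (Nat.cast : ℕ → ℚ) (card_precubicMap_zero (A := Fin n))
  rw [Nat.card_fin] at h
  unfold rootedCount
  push_cast at h
  rw [← mul_div_assoc, h, mul_div_assoc]

theorem rootedCount_zero_eq (h : ℕ) :
    rootedCount 0 (12 * h + 6) = 2 / 12 ^ (h + 1) * (6 * h + 3).factorial /
      ((h + 1).factorial * (3 * h + 1).factorial) := by
  induction h with
  | zero =>
    have h1 := rootedCount_zero 6 (by norm_num)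
    have h2 := rootedCount_succ 2 2 (by norm_num)
    have h3 : rootedCount 2 2 = 1 := by simp [rootedCount, card_precubicMap_two_fin_two]
    rw [h3] at h2
    norm_num [Nat.factorial] at h1 h2 ⊢
    linarith
  | succ h ih =>
    have h1 := rootedCount_zero (12 * h + 18) (by omega)
    have h2 := rootedCount_succ 2 (12 * h + 14) (by omega)
    have h3 := rootedCount_succ 1 (12 * h + 10) (by omega)
    have h4 := rootedCount_succ 0 (12 * h + 6) (by omega)
    rw [ih] at h4
    simp only [Nat.reduceAdd, add_assoc] at h1 h2 h3 h4
    push_cast at h1 h2 h3 h4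
    have f6 : (6 * h + 9).factorial = (6 * h + 9) * ((6 * h + 8) * ((6 * h + 7) *
        ((6 * h + 6) * ((6 * h + 5) * ((6 * h + 4) * (6 * h + 3).factorial))))) := by
      simp only [Nat.factorial_succ]
    have f3 : (3 * h + 4).factorial =
        (3 * h + 4) * ((3 * h + 3) * ((3 * h + 2) * (3 * h + 1).factorial)) := by
      simp only [Nat.factorial_succ]
    rw [show 12 * (h + 1) + 6 = 12 * h + 18 by ring, show 6 * (h + 1) + 3 = 6 * h + 9 by ring,
      show 3 * (h + 1) + 1 = 3 * h + 4 by ring, f6, f3, Nat.factorial_succ (h + 1)]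
    push_cast
    have e4 : rootedCount 1 (12 * h + 10) = (12 * h + 10) * (2 / 12 ^ (h + 1) *
        (6 * h + 3).factorial / ((h + 1).factorial * (3 * h + 1).factorial)) := by
      linear_combination h4
    have e3 : rootedCount 2 (12 * h + 14) = (12 * h + 14) / 2 * rootedCount 1 (12 * h + 10) := by
      linear_combination h3 / 2
    have e2 : rootedCount 3 (12 * h + 18) = (12 * h + 18) / 3 * rootedCount 2 (12 * h + 14) := by
      linear_combination h2 / 3
    have e1 : rootedCount 0 (12 * h + 18) = 6 / (12 * h + 24) * rootedCount 3 (12 * h + 18) := by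
      field_simp
      linear_combination h1
    rw [e1, e2, e3, e4]
    generalize (6 * h + 3).factorial = a
    have hb : ((h + 1).factorial : ℚ) ≠ 0 := by positivity
    have hc : ((3 * h + 1).factorial : ℚ) ≠ 0 := by positivity
    generalize ((h + 1).factorial : ℚ) = b at *
    generalize ((3 * h + 1).factorial : ℚ) = c at *
    field_simp
    ring

end Count

section Rooted

variable {A : Type}

instance (k : ℕ) : MulAction (Perm A) (PrecubicMap k A) where
  smul e x := ⟨(e.permCongr x.1.1, e.permCongr x.1.2), x.2.permCongr e⟩
  one_smul _ := rfl
  mul_smul _ _ _ := rfl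

lemma stabilizer_rooted_eq_bot {k : ℕ} (x : PrecubicMap k A × A) :
    MulAction.stabilizer (Perm A) x = ⊥ := by
  obtain ⟨⟨⟨σ, α⟩, h⟩, r⟩ := x
  rw [eq_bot_iff]
  intro e he
  rw [MulAction.mem_stabilizer_iff] at he
  have hσ : e.permCongr σ = σ := congrArg (fun y => y.1.1.1) he
  have hα : e.permCongr α = α := congrArg (fun y => y.1.1.2) he
  have hr : e r = r := congrArg Prod.snd he
  have hc : Commute e (σ * α) := by
    ext d
    have h1 := Equiv.congr_fun hσ (e (α d))
    have h2 := Equiv.congr_fun hα (e d)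
    simp only [permCongr_apply, symm_apply_apply] at h1 h2
    simp only [Perm.mul_apply, h1, h2]
  rw [Subgroup.mem_bot]
  ext d
  obtain ⟨n, rfl⟩ := h.full r d
  rw [← Perm.mul_apply, (hc.zpow_right n).eq, Perm.mul_apply, hr, Perm.one_apply]

lemma orbitCount_eq_one_iff {m : ℕ} [NeZero m] (π : Perm (Fin m)) :
    orbitCount π = 1 ↔ IsFullCycle π := by
  rw [orbitCount, Nat.card_eq_one_iff_unique]
  have key : ∀ x y, (Quotient.mk (MulAction.orbitRel (Subgroup.zpowers π) (Fin m)) x =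
      Quotient.mk _ y) ↔ π.SameCycle y x := by
    intro x y
    rw [Quotient.eq, MulAction.orbitRel_apply, MulAction.mem_orbit_iff]
    constructor
    · rintro ⟨⟨g, n, rfl⟩, h⟩
      exact ⟨n, h⟩
    · rintro ⟨n, h⟩
      exact ⟨⟨π ^ n, n, rfl⟩, h⟩
  constructor
  · rintro ⟨h, -⟩ x y
    exact (key y x).1 (Subsingleton.elim _ _)
  · intro h
    refine ⟨⟨fun a b => ?_⟩, ⟨Quotient.mk _ 0⟩⟩
    induction a using Quotient.inductionOn
    induction b using Quotient.inductionOn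
    exact (key _ _).2 (h _ _)

/-- Rooted one-face cubic maps as one-face cubic maps with a chosen dart. -/
def oneFaceCubicEquiv (g : ℕ) [NeZero (2 * (6 * g - 3))] :
    {M : RootedMap (2 * (6 * g - 3)) // IsOneFaceCubic M} ≃
      PrecubicMap 0 (Fin (2 * (6 * g - 3))) × Fin (2 * (6 * g - 3)) where
  toFun M := (⟨(M.1.σ, M.1.α), {
    invol := M.1.α_invol
    fpf := M.1.α_fpf
    cube := fun d => (M.2.1 d).1
    full := (orbitCount_eq_one_iff _).1 M.2.2
    leaves := by
      rw [Finite.card_eq_zero_iff]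
      exact ⟨fun d => (M.2.1 d.1).2 d.2⟩ }⟩, M.1.root)
  invFun x := ⟨{
    σ := x.1.1.1
    α := x.1.1.2
    root := x.2
    α_invol := x.1.2.invol
    α_fpf := x.1.2.fpf
    connected := fun d e => by
      obtain ⟨n, hn⟩ := x.1.2.full d e
      exact ⟨_, zpow_mem (mul_mem (Subgroup.subset_closure (by simp))
        (Subgroup.subset_closure (by simp))) n, hn⟩ },
    fun d => ⟨x.1.2.cube d, x.1.2.ne_of_zero d⟩,
    (orbitCount_eq_one_iff _).2 x.1.2.full⟩
  left_inv _ := rfl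
  right_inv _ := rfl

lemma card_quot_mapIso (g : ℕ) (hg : 1 ≤ g) :
    (Nat.card (Quot (fun M M' : {M : RootedMap (2 * (6 * g - 3)) // IsOneFaceCubic M} =>
        MapIso M.1 M'.1)) : ℚ) = rootedCount 0 (2 * (6 * g - 3)) := by
  have : NeZero (2 * (6 * g - 3)) := ⟨by omega⟩
  have hquot : Nat.card (Quot (fun M M' : {M : RootedMap (2 * (6 * g - 3)) // IsOneFaceCubic M} =>
        MapIso M.1 M'.1)) = Nat.card (Quotient (MulAction.orbitRel
          (Perm (Fin (2 * (6 * g - 3))))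
          (PrecubicMap 0 (Fin (2 * (6 * g - 3))) × Fin (2 * (6 * g - 3))))) := by
    refine Nat.card_congr (Quot.congr (oneFaceCubicEquiv g) fun M M' => ?_)
    rw [MulAction.orbitRel_apply, MulAction.mem_orbit_symm, MulAction.mem_orbit_iff]
    refine exists_congr fun e => ?_
    have hc : ∀ σ τ : Perm (Fin (2 * (6 * g - 3))),
        (∀ d, e (σ d) = τ (e d)) ↔ e.permCongr σ = τ := by
      intro σ τ
      have := e.forall_congr_right (q := fun x => e (σ (e.symm x)) = τ x)
      simpa [Equiv.ext_iff] using this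
    rw [hc, hc, Prod.ext_iff, Subtype.ext_iff, Prod.ext_iff, and_assoc]
    rfl
  have h := Nat.card_congr (MulAction.selfEquivOrbitsQuotientProd
    (stabilizer_rooted_eq_bot (k := 0) (A := Fin (2 * (6 * g - 3)))))
  rw [Nat.card_prod, Nat.card_prod, ← hquot, Nat.card_perm, Nat.card_fin] at h
  clear hquot
  generalize Nat.card (Quot _) = q at h ⊢
  unfold rootedCount
  generalize 2 * (6 * g - 3) = n at *
  obtain ⟨m, rfl⟩ : ∃ m, n = m + 1 := ⟨n - 1, by have := this.out; omega⟩
  rw [Nat.factorial_succ, mul_comm (m + 1), ← mul_assoc] at h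
  rw [Nat.eq_of_mul_eq_mul_right m.succ_pos h, Nat.add_sub_cancel]
  push_cast
  field_simp

end Rooted

/-- The number of rooted one-face cubic maps of genus `g` (which
necessarily have `4g-2` vertices and `6g-3` edges) is
`(2/12^g) · (6g-3)! / (g! · (3g-2)!)`. -/
theorem stmt_18 (g : ℕ) (hg : 1 ≤ g) :
    (Nat.card (Quot (fun M M' : {M : RootedMap (2 * (6 * g - 3)) // IsOneFaceCubic M} =>
        MapIso M.1 M'.1)) : ℚ)
      = 2 / 12 ^ g * Nat.factorial (6 * g - 3) /
          (Nat.factorial g * Nat.factorial (3 * g - 2)) := by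
  rw [card_quot_mapIso g hg]
  obtain ⟨h, rfl⟩ : ∃ h, g = h + 1 := ⟨g - 1, by omega⟩
  rw [show 2 * (6 * (h + 1) - 3) = 12 * h + 6 by omega, rootedCount_zero_eq,
    show 6 * (h + 1) - 3 = 6 * h + 3 by omega, show 3 * (h + 1) - 2 = 3 * h + 1 by omega]
end
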